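/- arXiv:1909.02610 — 3 statements merged into one kernel-verified Lean document; each statement's English description precedes it below -/
import Mathlib

section
/- For every integer n ≥ 3, ⌈(n−1)/3⌉ ≤ sdepth(S_{n,2}/I(C_{n,2})) ≤ ⌈n/3⌉. -/
open MvPolynomial

section Defs

variable (K : Type) [Field K] (σ : Type)
variable (M : Type) [AddCommGroup M] [Module K M] [Module (MvPolynomial σ K) M]
  [IsScalarTower K (MvPolynomial σ K) M]

/-- The Stanley space `w K[A]`: the `K`-span of `{u • w : u a monomial in the variables of A}`. -/
noncomputable def stanleySpace (w : M) (A : Finset σ) : Submodule K M :=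
  Submodule.span K { m | ∃ u : σ →₀ ℕ, (↑u.support : Set σ) ⊆ ↑A ∧
    m = (monomial u (1 : K) : MvPolynomial σ K) • w }

/-- `(w, A)` indexed by `Fin r` gives a Stanley decomposition of `M`:
each Stanley space `wᵢ K[Aᵢ]` is a free `K[Aᵢ]`-module and `M` is their internal direct
sum as a `K`-vector space. -/
def IsStanleyDecomp {r : ℕ} (w : Fin r → M) (A : Fin r → Finset σ) : Prop :=
  (∀ i (f : MvPolynomial σ K), (↑f.vars : Set σ) ⊆ ↑(A i) → f • w i = 0 → f = 0) ∧
  (iSupIndep fun i => stanleySpace K σ M (w i) (A i)) ∧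
  (⨆ i, stanleySpace K σ M (w i) (A i)) = ⊤

/-- The Stanley depth of `M`: the largest value of `minᵢ |Aᵢ|` over all Stanley
decompositions of `M`. -/
noncomputable def sdepth : ℕ :=
  sSup { d | ∃ r, ∃ w : Fin r → M, ∃ A : Fin r → Finset σ,
    IsStanleyDecomp K σ M w A ∧ d = sInf (Set.range fun i => (A i).card) }

/-- The depth of `M` with respect to the maximal graded ideal `(x₁, …, x_N)`:
the maximal length of an `M`-regular sequence of elements of that ideal. -/
noncomputable def rdepth : ℕ :=
  sSup { d | ∃ rs : List (MvPolynomial σ K), rs.length = d ∧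
    (∀ f ∈ rs, f ∈ Ideal.span (Set.range (X : σ → MvPolynomial σ K))) ∧
    RingTheory.Sequence.IsRegular M rs }

end Defs

/-- Adjacency in the strong product `Pₙ ⊠ Pₘ` (vertices `(i,j)`, `0`-indexed): distinct
vertices are adjacent iff both coordinates differ by at most `1`. -/
def pAdj (n m : ℕ) (a b : Fin n × Fin m) : Prop :=
  a ≠ b ∧ |((a.1 : ℤ) - (b.1 : ℤ))| ≤ 1 ∧ |((a.2 : ℤ) - (b.2 : ℤ))| ≤ 1

/-- Adjacency in the strong product `Cₙ ⊠ Pₘ` (vertices `(i,j)`, `0`-indexed). -/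
def cAdj (n m : ℕ) (a b : Fin n × Fin m) : Prop :=
  a ≠ b ∧ min ((a.1 : ℤ) - (b.1 : ℤ)).natAbs (n - ((a.1 : ℤ) - (b.1 : ℤ)).natAbs) ≤ 1 ∧
    |((a.2 : ℤ) - (b.2 : ℤ))| ≤ 1

/-- The edge ideal of the graph with vertex set `V` and adjacency relation `Adj`. -/
noncomputable def edgeIdeal (K : Type) [Field K] {V : Type} (Adj : V → V → Prop) :
    Ideal (MvPolynomial V K) :=
  Ideal.span { p | ∃ a b : V, Adj a b ∧ p = X a * X b }



/-- Independent sets of a relation. -/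
def IndepSet {V : Type} (Adj : V → V → Prop) (T : Finset V) : Prop :=
  ∀ a ∈ T, ∀ b ∈ T, ¬ Adj a b

lemma mem_edgeIdeal_iff (K : Type) [Field K] {V : Type} [DecidableEq V] (Adj : V → V → Prop)
    (hirr : ∀ a, ¬ Adj a a) (p : MvPolynomial V K) :
    p ∈ edgeIdeal K Adj ↔ ∀ m ∈ p.support, ¬ IndepSet Adj m.support := by
  have h : edgeIdeal K Adj = Ideal.span ((fun s => monomial s (1 : K)) ''
      {s | ∃ a b : V, Adj a b ∧ s = Finsupp.single a 1 + Finsupp.single b 1}) := by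
    unfold edgeIdeal
    congr 1
    ext p
    simp only [Set.mem_ofPred_eq, Set.mem_image]
    constructor
    · rintro ⟨a, b, hab, rfl⟩
      exact ⟨_, ⟨a, b, hab, rfl⟩, by simp [X, monomial_mul]⟩
    · rintro ⟨s, ⟨a, b, hab, rfl⟩, rfl⟩
      exact ⟨a, b, hab, by simp [X, monomial_mul]⟩
  rw [h, mem_ideal_span_monomial_image]
  refine forall₂_congr fun m _ => ?_
  constructor
  · rintro ⟨s, ⟨a, b, hab, rfl⟩, hle⟩ hI
    have ha := hle a
    have hb := hle b
    simp only [Finsupp.add_apply, Finsupp.single_eq_same] at ha hb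
    exact hI a (by simp; omega) b (by simp; omega) hab
  · intro hI
    unfold IndepSet at hI
    push Not at hI
    obtain ⟨a, ha, b, hb, hab⟩ := hI
    refine ⟨_, ⟨a, b, hab, rfl⟩, ?_⟩
    have hne : a ≠ b := fun e => hirr a (by rw [← e] at hab; exact hab)
    intro c
    simp only [Finsupp.mem_support_iff] at ha hb
    simp only [Finsupp.add_apply, Finsupp.single_apply]
    split_ifs with h1 h2 h2
    · exact absurd (h1.trans h2.symm) hne
    · subst h1; omega
    · subst h2; omega
    · omega

lemma exists_coeff_functional (K : Type) [Field K] {V : Type} [DecidableEq V]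
    (Adj : V → V → Prop) (hirr : ∀ a, ¬ Adj a a) (m : V →₀ ℕ) (hm : IndepSet Adj m.support) :
    ∃ φ : (MvPolynomial V K ⧸ edgeIdeal K Adj) →ₗ[K] K,
      ∀ p, φ (Ideal.Quotient.mk _ p) = coeff m p := by
  have hz : ∀ p ∈ edgeIdeal K Adj, coeff m p = 0 := by
    intro p hp
    by_contra hc
    exact (mem_edgeIdeal_iff K Adj hirr p).1 hp m (by simpa using hc) hm
  refine ⟨((edgeIdeal K Adj).restrictScalars K).liftQ (lcoeff K m) ?_ , ?_⟩
  · intro p hp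
    exact hz p hp
  · intro p
    rfl


lemma exists_small_of_facet (K : Type) [Field K] {V : Type} [DecidableEq V]
    (Adj : V → V → Prop) (hirr : ∀ a, ¬ Adj a a) (D : Finset V) (hD : IndepSet Adj D)
    (hmax : ∀ v, v ∉ D → ∃ d ∈ D, Adj v d) {r : ℕ}
    (w : Fin r → MvPolynomial V K ⧸ edgeIdeal K Adj) (A : Fin r → Finset V)
    (h : IsStanleyDecomp K V (MvPolynomial V K ⧸ edgeIdeal K Adj) w A) :
    ∃ i, (A i).card ≤ D.card := by
  by_contra hcon
  push Not at hcon
  obtain ⟨h1, -, h3⟩ := h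
  have hA : ∀ i, ∃ d ∈ D, d ∉ A i := by
    intro i
    by_contra hc
    push Not at hc
    obtain ⟨v, hv, hvD⟩ := Finset.exists_mem_notMem_of_card_lt_card (hcon i)
    obtain ⟨d, hd, hvd⟩ := hmax v hvD
    have h0 : (X v * X d : MvPolynomial V K) = 0 := by
      apply h1 i
      · intro x hx
        have := vars_mul _ _ hx
        simp only [vars_X, Finset.mem_union, Finset.mem_singleton] at this
        rcases this with rfl | rfl
        · exact hv
        · exact hc _ hd
      · obtain ⟨p, hp⟩ := Ideal.Quotient.mk_surjective (w i)
        rw [← hp]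
        change Ideal.Quotient.mk _ ((X v * X d) * p) = 0
        rw [Ideal.Quotient.eq_zero_iff_mem]
        exact Ideal.mul_mem_right _ _ (Ideal.subset_span ⟨v, d, hvd, rfl⟩)
    rcases mul_eq_zero.1 h0 with h | h <;> exact X_ne_zero _ h
  choose p hp using fun i => Ideal.Quotient.mk_surjective (w i)
  obtain ⟨N, hN⟩ : ∃ N : ℕ, ∀ i, (p i).totalDegree ≤ N :=
    ⟨∑ i, (p i).totalDegree, fun i =>
      Finset.single_le_sum (f := fun i => (p i).totalDegree) (fun _ _ => Nat.zero_le _)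
        (Finset.mem_univ i)⟩
  let m : V →₀ ℕ := Finsupp.indicator D (fun _ _ => N + 1)
  have hmv : ∀ d ∈ D, m d = N + 1 := fun d hd => Finsupp.indicator_of_mem hd _
  have hms : m.support ⊆ D := Finsupp.support_indicator_subset _ _
  have hm : IndepSet Adj m.support := fun a ha b hb => hD a (hms ha) b (hms hb)
  obtain ⟨φ, hφ⟩ := exists_coeff_functional K Adj hirr m hm
  have hle : (⨆ i, stanleySpace K V _ (w i) (A i)) ≤ LinearMap.ker φ := by
    refine iSup_le fun i => Submodule.span_le.2 ?_
    rintro _ ⟨u, hu, rfl⟩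
    rw [SetLike.mem_coe, LinearMap.mem_ker, ← hp i]
    change φ (Ideal.Quotient.mk _ (monomial u 1 * p i)) = 0
    rw [hφ, coeff_monomial_mul']
    split_ifs with hum
    · rw [one_mul]
      by_contra hc
      obtain ⟨d, hd, hdA⟩ := hA i
      have hu0 : u d = 0 := by
        by_contra h
        exact hdA (hu (by simpa using h))
      have h4 := le_totalDegree (mem_support_iff.2 hc)
      have h5 : (m - u) d ≤ (m - u).sum fun _ e => e := by
        by_cases hz : (m - u) d = 0
        · omega
        · exact Finset.single_le_sum (f := fun x => (m - u) x) (fun _ _ => Nat.zero_le _)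
            (Finsupp.mem_support_iff.2 hz)
      rw [Finsupp.tsub_apply, hmv d hd, hu0] at h5
      have := hN i
      omega
    · rfl
  rw [h3] at hle
  have := hφ (monomial m 1)
  rw [coeff_monomial, if_pos rfl] at this
  have h0 : φ (Ideal.Quotient.mk _ (monomial m 1)) = 0 := hle Submodule.mem_top
  rw [h0] at this
  exact zero_ne_one this

/-- `Δ` is partitioned into finitely many intervals whose tops have at least `d` elements. -/
def IntPart {V : Type} (Δ : Set (Finset V)) (d : ℕ) : Prop :=
  ∃ (ι : Type) (_ : Finite ι) (F G : ι → Finset V), (∀ i, F i ⊆ G i) ∧ (∀ i, d ≤ (G i).card) ∧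
    (∀ i T, F i ⊆ T → T ⊆ G i → T ∈ Δ) ∧ (∀ T ∈ Δ, ∃ i, F i ⊆ T ∧ T ⊆ G i) ∧
    (∀ T i j, F i ⊆ T → T ⊆ G i → F j ⊆ T → T ⊆ G j → i = j)

lemma exists_decomp_of_part (K : Type) [Field K] {V : Type} [DecidableEq V]
    (Adj : V → V → Prop) (hirr : ∀ a, ¬ Adj a a) (d : ℕ)
    (hP : IntPart {T | IndepSet Adj T} d) :
    ∃ r, ∃ w : Fin r → MvPolynomial V K ⧸ edgeIdeal K Adj, ∃ A : Fin r → Finset V,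
    IsStanleyDecomp K V (MvPolynomial V K ⧸ edgeIdeal K Adj) w A ∧
      d ≤ sInf (Set.range fun i => (A i).card) := by
  obtain ⟨r, F, G, hFG, hd, hin, hex, huniq⟩ :
      ∃ (r : ℕ) (F G : Fin r → Finset V), (∀ i, F i ⊆ G i) ∧ (∀ i, d ≤ (G i).card) ∧
      (∀ i T, F i ⊆ T → T ⊆ G i → T ∈ {T | IndepSet Adj T}) ∧
      (∀ T ∈ {T | IndepSet Adj T}, ∃ i, F i ⊆ T ∧ T ⊆ G i) ∧
      (∀ T i j, F i ⊆ T → T ⊆ G i → F j ⊆ T → T ⊆ G j → i = j) := by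
    obtain ⟨ι, hι, F, G, hFG, hd, hin, hex, huniq⟩ := hP
    obtain ⟨r, ⟨f⟩⟩ := Finite.exists_equiv_fin ι
    refine ⟨r, F ∘ f.symm, G ∘ f.symm, fun i => hFG _, fun i => hd _, fun i => hin _, ?_, ?_⟩
    · intro T hT
      obtain ⟨i, hi⟩ := hex T hT
      exact ⟨f i, by simpa using hi⟩
    · intro T i j h1 h2 h3 h4
      exact f.symm.injective (huniq T _ _ h1 h2 h3 h4)
  let e : Fin r → V →₀ ℕ := fun i => Finsupp.indicator (F i) (fun _ _ => 1)
  have he1 : ∀ i, ∀ v ∈ F i, e i v = 1 := fun i v hv => Finsupp.indicator_of_mem hv _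
  have he0 : ∀ i, ∀ v, v ∉ F i → e i v = 0 := fun i v hv => Finsupp.indicator_of_notMem hv _
  have hsupp : ∀ i (u : V →₀ ℕ), (↑u.support : Set V) ⊆ ↑(G i) →
      F i ⊆ (u + e i).support ∧ (u + e i).support ⊆ G i := by
    intro i u hu
    constructor
    · intro v hv
      have := he1 i v hv
      simp [this]
    · intro v hv
      by_cases hvF : v ∈ F i
      · exact hFG i hvF
      · have := he0 i v hvF
        simp [this] at hv
        exact hu (by simpa using hv)
  refine ⟨r, fun i => Ideal.Quotient.mk _ (monomial (e i) 1), G, ⟨?_, ?_, ?_⟩, ?_⟩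
  · intro i f hf h0
    change Ideal.Quotient.mk _ (f * monomial (e i) 1) = 0 at h0
    rw [Ideal.Quotient.eq_zero_iff_mem, mem_edgeIdeal_iff K Adj hirr] at h0
    by_contra hne
    obtain ⟨m, hm⟩ := Finset.nonempty_of_ne_empty (fun h => hne (support_eq_empty.1 h))
    have hmG : (↑m.support : Set V) ⊆ ↑(G i) := by
      intro v hv
      exact hf ((mem_vars_iff_mem_support v).2 ⟨m, hm, hv⟩)
    obtain ⟨h1, h2⟩ := hsupp i m hmG
    refine h0 (m + e i) ?_ (hin i _ h1 h2)
    rw [mem_support_iff, coeff_mul_monomial, mul_one]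
    exact mem_support_iff.1 hm
  · -- independence
    have key : ∀ (m : V →₀ ℕ) (φ : (MvPolynomial V K ⧸ edgeIdeal K Adj) →ₗ[K] K),
        (∀ p, φ (Ideal.Quotient.mk _ p) = coeff m p) → ∀ i,
        ¬ (F i ⊆ m.support ∧ m.support ⊆ G i) →
        stanleySpace K V (MvPolynomial V K ⧸ edgeIdeal K Adj)
          (Ideal.Quotient.mk _ (monomial (e i) 1)) (G i) ≤ LinearMap.ker φ := by
      intro m φ hφ i hi
      refine Submodule.span_le.2 ?_
      rintro _ ⟨u, hu, rfl⟩
      rw [SetLike.mem_coe, LinearMap.mem_ker]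
      change φ (Ideal.Quotient.mk _ (monomial u 1 * monomial (e i) 1)) = 0
      rw [hφ, monomial_mul, coeff_monomial, if_neg]
      rintro rfl
      exact hi (hsupp i u hu)
    rw [iSupIndep_def]
    intro i
    rw [Submodule.disjoint_def]
    intro x hx hx'
    obtain ⟨p, rfl⟩ := Ideal.Quotient.mk_surjective x
    rw [Ideal.Quotient.eq_zero_iff_mem, mem_edgeIdeal_iff K Adj hirr]
    intro m hm hI
    obtain ⟨φ, hφ⟩ := exists_coeff_functional K Adj hirr m hI
    apply mem_support_iff.1 hm
    rw [← hφ]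
    by_cases hi : F i ⊆ m.support ∧ m.support ⊆ G i
    · refine (iSup₂_le fun j hj => key m φ hφ j ?_) hx'
      rintro ⟨h1, h2⟩
      exact hj (huniq _ _ _ h1 h2 hi.1 hi.2)
    · exact key m φ hφ i hi hx
  · rw [eq_top_iff]
    rintro x -
    obtain ⟨p, rfl⟩ := Ideal.Quotient.mk_surjective x
    induction p using MvPolynomial.induction_on' with
    | add p q hp hq =>
      rw [map_add]
      exact Submodule.add_mem _ hp hq
    | monomial m c =>
      by_cases hI : IndepSet Adj m.support
      · obtain ⟨i, h1, h2⟩ := hex _ hI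
        refine Submodule.mem_iSup_of_mem i ?_
        have hle : e i ≤ m := by
          intro v
          by_cases hv : v ∈ F i
          · rw [he1 i v hv]
            have := h1 hv
            rw [Finsupp.mem_support_iff] at this
            omega
          · rw [he0 i v hv]
            exact Nat.zero_le _
        have hmc : (monomial m c : MvPolynomial V K) =
            c • (monomial (m - e i) 1 * monomial (e i) 1) := by
          rw [monomial_mul, tsub_add_cancel_of_le hle, smul_monomial]
          simp
        rw [hmc]
        have hmem : (Ideal.Quotient.mk (edgeIdeal K Adj)
            (monomial (m - e i) 1 * monomial (e i) 1)) ∈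
            stanleySpace K V (MvPolynomial V K ⧸ edgeIdeal K Adj)
              (Ideal.Quotient.mk _ (monomial (e i) 1)) (G i) := by
          refine Submodule.subset_span ⟨m - e i, ?_, rfl⟩
          intro v hv
          apply h2
          simp only [Finset.mem_coe, Finsupp.mem_support_iff, Finsupp.tsub_apply] at hv ⊢
          omega
        exact Submodule.smul_mem _ c hmem
      · have : Ideal.Quotient.mk (edgeIdeal K Adj) (monomial m c) = 0 := by
          rw [Ideal.Quotient.eq_zero_iff_mem, mem_edgeIdeal_iff K Adj hirr]
          intro m' hm'
          have := support_monomial_subset hm'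
          rw [Finset.mem_singleton] at this
          rwa [this]
        rw [this]
        exact Submodule.zero_mem _
  · rcases Nat.eq_zero_or_pos r with hr | hr
    · subst hr
      obtain ⟨i, -⟩ := hex ∅ (by simp [IndepSet])
      exact i.elim0
    · have : Nonempty (Fin r) := ⟨⟨0, hr⟩⟩
      refine le_csInf (Set.range_nonempty _) ?_
      rintro _ ⟨i, rfl⟩
      exact hd i

lemma IntPart.mono {V : Type} {Δ : Set (Finset V)} {d d' : ℕ} (h : IntPart Δ d) (hd : d' ≤ d) :
    IntPart Δ d' := by
  obtain ⟨ι, hι, F, G, h1, h2, h3⟩ := h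
  exact ⟨ι, hι, F, G, h1, fun i => hd.trans (h2 i), h3⟩

lemma IntPart.single_empty {V : Type} : IntPart {(∅ : Finset V)} 0 :=
  ⟨Unit, inferInstance, fun _ => ∅, fun _ => ∅, by simp, by simp,
    by simp, by simp, by simp⟩

lemma IntPart.union {V : Type} {Δ₁ Δ₂ : Set (Finset V)} {d : ℕ} (h₁ : IntPart Δ₁ d)
    (h₂ : IntPart Δ₂ d) (hdis : ∀ T ∈ Δ₁, T ∉ Δ₂) : IntPart (Δ₁ ∪ Δ₂) d := by
  obtain ⟨ι, hι, F, G, a1, a2, a3, a4, a5⟩ := h₁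
  obtain ⟨κ, hκ, F', G', b1, b2, b3, b4, b5⟩ := h₂
  refine ⟨ι ⊕ κ, inferInstance, Sum.elim F F', Sum.elim G G', ?_, ?_, ?_, ?_, ?_⟩
  · rintro (i | i)
    exacts [a1 i, b1 i]
  · rintro (i | i)
    exacts [a2 i, b2 i]
  · rintro (i | i) T h h'
    exacts [Or.inl (a3 i T h h'), Or.inr (b3 i T h h')]
  · rintro T (hT | hT)
    · obtain ⟨i, hi⟩ := a4 T hT
      exact ⟨Sum.inl i, hi⟩
    · obtain ⟨i, hi⟩ := b4 T hT
      exact ⟨Sum.inr i, hi⟩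
  · rintro T (i | i) (j | j) h1 h2 h3 h4
    · exact congrArg _ (a5 T i j h1 h2 h3 h4)
    · exact absurd (b3 j T h3 h4) (hdis T (a3 i T h1 h2))
    · exact absurd (b3 i T h1 h2) (hdis T (a3 j T h3 h4))
    · exact congrArg _ (b5 T i j h1 h2 h3 h4)

lemma IntPart.ins {V : Type} [DecidableEq V] {Δ : Set (Finset V)} {d : ℕ} (h : IntPart Δ d)
    (v : V) (hv : ∀ T ∈ Δ, v ∉ T) : IntPart {T | v ∈ T ∧ T.erase v ∈ Δ} (d + 1) := by
  obtain ⟨ι, hι, F, G, a1, a2, a3, a4, a5⟩ := h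
  have hG : ∀ i, v ∉ G i := fun i => hv _ (a3 i _ (a1 i) subset_rfl)
  have hF : ∀ i, v ∉ F i := fun i hi => hG i (a1 i hi)
  have hl : ∀ i T, insert v (F i) ⊆ T → F i ⊆ T.erase v := by
    intro i T h x hx
    exact Finset.mem_erase.2 ⟨fun e => hF i (e ▸ hx), h (Finset.mem_insert_of_mem hx)⟩
  have hr : ∀ i T, T ⊆ insert v (G i) → T.erase v ⊆ G i := by
    intro i T h
    exact Finset.subset_insert_iff.1 h
  refine ⟨ι, hι, fun i => insert v (F i), fun i => insert v (G i), ?_, ?_, ?_, ?_, ?_⟩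
  · exact fun i => Finset.insert_subset_insert _ (a1 i)
  · intro i
    rw [Finset.card_insert_of_notMem (hG i)]
    exact Nat.succ_le_succ (a2 i)
  · intro i T h1 h2
    exact ⟨h1 (Finset.mem_insert_self _ _), a3 i _ (hl i T h1) (hr i T h2)⟩
  · rintro T ⟨hvT, hT⟩
    obtain ⟨i, h1, h2⟩ := a4 _ hT
    exact ⟨i, Finset.insert_subset hvT (h1.trans (Finset.erase_subset _ _)),
      Finset.subset_insert_iff.2 h2⟩
  · intro T i j h1 h2 h3 h4
    exact a5 (T.erase v) i j (hl i T h1) (hr i T h2) (hl j T h3) (hr j T h4)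

lemma IntPart.cone {V : Type} [DecidableEq V] {Δ : Set (Finset V)} {d : ℕ} (h : IntPart Δ d)
    (v : V) (hv : ∀ T ∈ Δ, v ∉ T) : IntPart {T | T.erase v ∈ Δ} (d + 1) := by
  obtain ⟨ι, hι, F, G, a1, a2, a3, a4, a5⟩ := h
  have hG : ∀ i, v ∉ G i := fun i => hv _ (a3 i _ (a1 i) subset_rfl)
  have hF : ∀ i, v ∉ F i := fun i hi => hG i (a1 i hi)
  have hl : ∀ i T, F i ⊆ T → F i ⊆ T.erase v := by
    intro i T h x hx
    exact Finset.mem_erase.2 ⟨fun e => hF i (e ▸ hx), h hx⟩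
  have hr : ∀ i T, T ⊆ insert v (G i) → T.erase v ⊆ G i := by
    intro i T h
    exact Finset.subset_insert_iff.1 h
  refine ⟨ι, hι, F, fun i => insert v (G i), ?_, ?_, ?_, ?_, ?_⟩
  · exact fun i => (a1 i).trans (Finset.subset_insert _ _)
  · intro i
    rw [Finset.card_insert_of_notMem (hG i)]
    exact Nat.succ_le_succ (a2 i)
  · intro i T h1 h2
    exact a3 i _ (hl i T h1) (hr i T h2)
  · intro T hT
    obtain ⟨i, h1, h2⟩ := a4 _ hT
    exact ⟨i, h1.trans (Finset.erase_subset _ _), Finset.subset_insert_iff.2 h2⟩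
  · intro T i j h1 h2 h3 h4
    exact a5 (T.erase v) i j (hl i T h1) (hr i T h2) (hl j T h3) (hr j T h4)

/-- Independent sets of the strong product of a path and an edge, on the columns `a ≤ c < b`. -/
def segInd (n a b : ℕ) : Set (Finset (Fin n × Fin 2)) :=
  {T | (∀ x ∈ T, a ≤ x.1.val ∧ x.1.val < b) ∧
    ∀ x ∈ T, ∀ y ∈ T, x ≠ y → x.1.val + 2 ≤ y.1.val ∨ y.1.val + 2 ≤ x.1.val}

lemma segInd_notMem {n a b : ℕ} (v : Fin n × Fin 2) (hv : v.1.val < a) :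
    ∀ T ∈ segInd n a b, v ∉ T := by
  intro T hT hvT
  have := (hT.1 v hvT).1
  omega

lemma vertex_ext {n : ℕ} {x y : Fin n × Fin 2} (h : x.1.val = y.1.val)
    (h' : x.2.val = y.2.val) : x = y := Prod.ext (Fin.ext h) (Fin.ext h')

/-- Deleting the vertex `v` of column `c` from an independent set. -/
lemma segInd_erase {n a b c : ℕ} {T : Finset (Fin n × Fin 2)} (hT : T ∈ segInd n a b)
    (v : Fin n × Fin 2) (hvT : v ∈ T) (hc : v.1.val = c) (hca : c ≤ a + 1) :
    T.erase v ∈ segInd n (c + 2) b := by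
  refine ⟨?_, ?_⟩
  · intro x hx
    rw [Finset.mem_erase] at hx
    have h1 := hT.1 x hx.2
    have h2 := hT.2 x hx.2 v hvT hx.1
    omega
  · intro x hx y hy
    exact hT.2 x (Finset.mem_of_mem_erase hx) y (Finset.mem_of_mem_erase hy)

lemma segInd_of_erase {n a b c : ℕ} {T : Finset (Fin n × Fin 2)}
    (v : Fin n × Fin 2) (hc : v.1.val = c) (hca : a ≤ c) (hcb : c < b)
    (hT : T.erase v ∈ segInd n (c + 2) b) : T ∈ segInd n a b := by
  have h0 : ∀ x ∈ T, x ≠ v → c + 2 ≤ x.1.val ∧ x.1.val < b := fun x hx hxv =>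
    hT.1 x (Finset.mem_erase.2 ⟨hxv, hx⟩)
  refine ⟨?_, ?_⟩
  · intro x hx
    by_cases hxv : x = v
    · subst hxv; omega
    · have := h0 x hx hxv
      omega
  · intro x hx y hy hxy
    by_cases hxv : x = v
    · subst hxv
      have := h0 y hy (Ne.symm hxy)
      omega
    · by_cases hyv : y = v
      · subst hyv
        have := h0 x hx hxv
        omega
      · exact hT.2 x (Finset.mem_erase.2 ⟨hxv, hx⟩) y (Finset.mem_erase.2 ⟨hyv, hy⟩) hxy

lemma not_two_in_seg {n a b : ℕ} {T : Finset (Fin n × Fin 2)} {u v : Fin n × Fin 2}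
    (hne : u ≠ v) (hu : u ∈ T) (hua : u.1.val < a) (hT : T.erase v ∈ segInd n a b) : False := by
  have := (hT.1 u (Finset.mem_erase.2 ⟨hne, hu⟩)).1
  omega

lemma segInd_part (n : ℕ) : ∀ k a b : ℕ, b ≤ n → b - a ≤ k →
    IntPart (segInd n a b) ((b - a + 2) / 3) := by
  intro k
  induction k using Nat.strong_induction_on with
  | _ k ih =>
  intro a b hbn hk
  by_cases hab : b ≤ a
  · have h1 : segInd n a b = {∅} := by
      ext T
      rw [Set.mem_singleton_iff]
      constructor
      · intro hT
        rw [Finset.eq_empty_iff_forall_notMem]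
        intro x hx
        have := hT.1 x hx
        omega
      · rintro rfl
        exact ⟨by simp, by simp⟩
    rw [h1]
    exact IntPart.single_empty.mono (by omega)
  push Not at hab
  have han : a < n := by omega
  let v0 : Fin n × Fin 2 := (⟨a, han⟩, 0)
  let v1 : Fin n × Fin 2 := (⟨a, han⟩, 1)
  have hv01 : v0 ≠ v1 := by simp [v0, v1]
  have p2 := ih (k - 1) (by omega) (a + 2) b hbn (by omega)
  have q0 := p2.cone v0 (segInd_notMem v0 (by simp [v0]))
  have q1 := p2.ins v1 (segInd_notMem v1 (by simp [v1]))
  have q01 := q0.union q1 (by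
    rintro T hT ⟨hT1, -⟩
    exact not_two_in_seg hv01.symm hT1 (by simp [v1]) hT)
  by_cases hab' : a + 1 < b
  · let u0 : Fin n × Fin 2 := (⟨a + 1, by omega⟩, 0)
    let u1 : Fin n × Fin 2 := (⟨a + 1, by omega⟩, 1)
    have hu01 : u0 ≠ u1 := by simp [u0, u1]
    have huv : ∀ u v : Fin n × Fin 2, u.1.val = a + 1 → v.1.val = a → u ≠ v := by
      rintro u v h1 h2 rfl
      omega
    have p3 := ih (k - 1) (by omega) (a + 3) b hbn (by omega)
    have r0 := p3.ins u0 (segInd_notMem u0 (by simp [u0]))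
    have r1 := p3.ins u1 (segInd_notMem u1 (by simp [u1]))
    have r01 := r0.union r1 (by
      rintro T ⟨-, hT⟩ ⟨hT1, -⟩
      exact not_two_in_seg hu01.symm hT1 (by simp [u1]) hT)
    have s := (q01.mono (d' := (b - a + 2) / 3) (by omega)).union
      (r01.mono (d' := (b - a + 2) / 3) (by omega)) (by
        rintro T (hT | ⟨-, hT⟩) (⟨hT1, -⟩ | ⟨hT1, -⟩)
        · exact not_two_in_seg (huv u0 v0 rfl rfl) hT1 (by simp [u0]) hT
        · exact not_two_in_seg (huv u1 v0 rfl rfl) hT1 (by simp [u1]) hT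
        · exact not_two_in_seg (huv u0 v1 rfl rfl) hT1 (by simp [u0]) hT
        · exact not_two_in_seg (huv u1 v1 rfl rfl) hT1 (by simp [u1]) hT)
    convert s using 1
    ext T
    constructor
    · intro hT
      by_cases h0 : u0 ∈ T
      · exact Or.inr (Or.inl ⟨h0, segInd_erase hT u0 h0 rfl (by omega)⟩)
      by_cases h1 : u1 ∈ T
      · exact Or.inr (Or.inr ⟨h1, segInd_erase hT u1 h1 rfl (by omega)⟩)
      by_cases h2 : v1 ∈ T
      · exact Or.inl (Or.inr ⟨h2, segInd_erase hT v1 h2 rfl (by omega)⟩)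
      refine Or.inl (Or.inl ⟨?_, ?_⟩)
      · intro x hx
        rw [Finset.mem_erase] at hx
        have h4 := hT.1 x hx.2
        have e0 : x ≠ u0 := fun e => h0 (e ▸ hx.2)
        have e1 : x ≠ u1 := fun e => h1 (e ▸ hx.2)
        have e2 : x ≠ v1 := fun e => h2 (e ▸ hx.2)
        have e3 := hx.1
        refine ⟨?_, h4.2⟩
        by_contra hlt
        have hx2 : x.2.val = 0 ∨ x.2.val = 1 := by omega
        have hx1 : x.1.val = a ∨ x.1.val = a + 1 := by omega
        rcases hx1 with hx1 | hx1 <;> rcases hx2 with hx2 | hx2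
        · exact e3 (vertex_ext hx1 hx2)
        · exact e2 (vertex_ext hx1 hx2)
        · exact e0 (vertex_ext hx1 hx2)
        · exact e1 (vertex_ext hx1 hx2)
      · intro x hx y hy
        exact hT.2 x (Finset.mem_of_mem_erase hx) y (Finset.mem_of_mem_erase hy)
    · rintro ((hT | ⟨-, hT⟩) | (⟨-, hT⟩ | ⟨-, hT⟩))
      · exact segInd_of_erase v0 rfl le_rfl hab hT
      · exact segInd_of_erase v1 rfl le_rfl hab hT
      · exact segInd_of_erase u0 rfl (Nat.le_succ a) hab' hT
      · exact segInd_of_erase u1 rfl (Nat.le_succ a) hab' hT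
  · have s := q01.mono (d' := (b - a + 2) / 3) (by omega)
    convert s using 1
    ext T
    constructor
    · intro hT
      by_cases h2 : v1 ∈ T
      · exact Or.inr ⟨h2, segInd_erase hT v1 h2 rfl (by omega)⟩
      refine Or.inl ⟨?_, ?_⟩
      · intro x hx
        rw [Finset.mem_erase] at hx
        have h4 := hT.1 x hx.2
        have e2 : x ≠ v1 := fun e => h2 (e ▸ hx.2)
        have hx2 : x.2.val = 0 ∨ x.2.val = 1 := by omega
        have hx1 : x.1.val = a := by omega
        rcases hx2 with hx2 | hx2
        · exact absurd (vertex_ext hx1 hx2) hx.1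
        · exact absurd (vertex_ext hx1 hx2) e2
      · intro x hx y hy
        exact hT.2 x (Finset.mem_of_mem_erase hx) y (Finset.mem_of_mem_erase hy)
    · rintro (hT | ⟨-, hT⟩)
      · exact segInd_of_erase v0 rfl le_rfl hab hT
      · exact segInd_of_erase v1 rfl le_rfl hab hT

lemma cAdj_iff {n : ℕ} (x y : Fin n × Fin 2) : cAdj n 2 x y ↔ x ≠ y ∧
    (x.1.val ≤ y.1.val + 1 ∧ y.1.val ≤ x.1.val + 1 ∨ n ≤ x.1.val + 1 - y.1.val ∨
      n ≤ y.1.val + 1 - x.1.val) := by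
  unfold cAdj
  have h1 := x.1.isLt
  have h2 := y.1.isLt
  have h3 := x.2.isLt
  have h4 := y.2.isLt
  have h5 : |((x.2 : ℤ) - (y.2 : ℤ))| ≤ 1 := by
    rw [abs_le]; constructor <;> omega
  refine and_congr_right fun hne => ?_
  rw [and_iff_left h5]
  omega

lemma cycle_part (n : ℕ) (hn : 3 ≤ n) :
    IntPart {T | IndepSet (cAdj n 2) T} ((n - 1 + 2) / 3) := by
  let v0 : Fin n × Fin 2 := (⟨0, by omega⟩, 0)
  let v1 : Fin n × Fin 2 := (⟨0, by omega⟩, 1)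
  have hv01 : v0 ≠ v1 := by simp [v0, v1]
  have p1 := segInd_part n n 1 n le_rfl (by omega)
  have p2 := segInd_part n n 2 (n - 1) (by omega) (by omega)
  have q0 := p2.ins v0 (segInd_notMem v0 (by simp [v0]))
  have q1 := p2.ins v1 (segInd_notMem v1 (by simp [v1]))
  have q01 := q0.union q1 (by
    rintro T ⟨-, hT⟩ ⟨hT1, -⟩
    exact not_two_in_seg hv01.symm hT1 (by simp [v1]) hT)
  have s := p1.union (q01.mono (d' := (n - 1 + 2) / 3) (by omega)) (by
    rintro T hT (⟨hT1, -⟩ | ⟨hT1, -⟩)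
    · exact segInd_notMem v0 (by simp [v0]) T hT hT1
    · exact segInd_notMem v1 (by simp [v1]) T hT hT1)
  convert s using 1
  have fwd : ∀ T, IndepSet (cAdj n 2) T → ∀ v ∈ T, v.1.val = 0 →
      T.erase v ∈ segInd n 2 (n - 1) := by
    intro T hT v hv hv0
    refine ⟨?_, ?_⟩
    · intro x hx
      rw [Finset.mem_erase] at hx
      have h1 := hT x hx.2 v hv
      rw [cAdj_iff, hv0] at h1
      have := x.1.isLt
      by_contra hc
      exact h1 ⟨hx.1, by omega⟩
    · intro x hx y hy hxy
      have := hT x (Finset.mem_of_mem_erase hx) y (Finset.mem_of_mem_erase hy)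
      rw [cAdj_iff] at this
      by_contra hc
      exact this ⟨hxy, by omega⟩
  have bwd : ∀ T, ∀ v ∈ T, v.1.val = 0 → T.erase v ∈ segInd n 2 (n - 1) →
      IndepSet (cAdj n 2) T := by
    intro T v hv hv0 hT x hx y hy hadj
    rw [cAdj_iff] at hadj
    obtain ⟨hxy, hadj⟩ := hadj
    have h0 : ∀ x ∈ T, x ≠ v → 2 ≤ x.1.val ∧ x.1.val < n - 1 := fun x hx hxv =>
      hT.1 x (Finset.mem_erase.2 ⟨hxv, hx⟩)
    by_cases hxv : x = v
    · subst hxv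
      have := h0 y hy (Ne.symm hxy)
      omega
    · by_cases hyv : y = v
      · subst hyv
        have := h0 x hx hxv
        omega
      · have := hT.2 x (Finset.mem_erase.2 ⟨hxv, hx⟩) y (Finset.mem_erase.2 ⟨hyv, hy⟩) hxy
        have := h0 x hx hxv
        have := h0 y hy hyv
        omega
  ext T
  constructor
  · intro hT
    by_cases h0 : v0 ∈ T
    · exact Or.inr (Or.inl ⟨h0, fwd T hT v0 h0 rfl⟩)
    by_cases h1 : v1 ∈ T
    · exact Or.inr (Or.inr ⟨h1, fwd T hT v1 h1 rfl⟩)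
    refine Or.inl ⟨?_, ?_⟩
    · intro x hx
      refine ⟨?_, x.1.isLt⟩
      by_contra hlt
      have hx1 : x.1.val = 0 := by omega
      have hx2 : x.2.val = 0 ∨ x.2.val = 1 := by omega
      rcases hx2 with hx2 | hx2
      · have e : x = v0 := vertex_ext hx1 hx2
        exact h0 (e ▸ hx)
      · have e : x = v1 := vertex_ext hx1 hx2
        exact h1 (e ▸ hx)
    · intro x hx y hy hxy
      have := hT x hx y hy
      rw [cAdj_iff] at this
      by_contra hc
      exact this ⟨hxy, by omega⟩
  · rintro (hT | ⟨hv, hT⟩ | ⟨hv, hT⟩)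
    · intro x hx y hy hadj
      rw [cAdj_iff] at hadj
      have h1 := hT.1 x hx
      have h2 := hT.1 y hy
      have h3 := hT.2 x hx y hy hadj.1
      have h4 := hadj.2
      omega
    · exact bwd T v0 hv rfl hT
    · exact bwd T v1 hv rfl hT

lemma exists_facet (n : ℕ) (hn : 3 ≤ n) : ∃ D : Finset (Fin n × Fin 2),
    IndepSet (cAdj n 2) D ∧ (∀ v, v ∉ D → ∃ d ∈ D, cAdj n 2 v d) ∧ D.card ≤ (n + 2) / 3 := by
  let f : ℕ → Fin n × Fin 2 := fun i => (⟨min (3 * i) (n - 2), by omega⟩, 0)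
  have hf : ∀ i, (f i).1.val = min (3 * i) (n - 2) := fun i => rfl
  refine ⟨(Finset.range ((n + 2) / 3)).image f, ?_, ?_, ?_⟩
  · intro x hx y hy hadj
    rw [Finset.mem_image] at hx hy
    obtain ⟨i, hi, rfl⟩ := hx
    obtain ⟨j, hj, rfl⟩ := hy
    rw [Finset.mem_range] at hi hj
    rw [cAdj_iff, hf, hf] at hadj
    obtain ⟨hne, hadj⟩ := hadj
    have hij : i ≠ j := fun e => hne (e ▸ rfl)
    omega
  · intro v hv
    have hlt := v.1.isLt
    obtain ⟨i, hi, hi'⟩ : ∃ i < (n + 2) / 3, (v.1.val ≤ min (3 * i) (n - 2) + 1 ∧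
        min (3 * i) (n - 2) ≤ v.1.val + 1 ∨ n ≤ v.1.val + 1 - min (3 * i) (n - 2)) := by
      by_cases h1 : v.1.val + 1 = n
      · exact ⟨0, by omega, by omega⟩
      · exact ⟨(v.1.val + 1) / 3, by omega, by omega⟩
    have hm : f i ∈ (Finset.range ((n + 2) / 3)).image f :=
      Finset.mem_image_of_mem f (Finset.mem_range.2 hi)
    refine ⟨f i, hm, ?_⟩
    rw [cAdj_iff, hf]
    refine ⟨fun e => hv (e ▸ hm), ?_⟩
    omega
  · exact Finset.card_image_le.trans (by simp)

/-- For every integer `n ≥ 3`, `⌈(n−1)/3⌉ ≤ sdepth(S_{n,2}/I(C_{n,2})) ≤ ⌈n/3⌉`. -/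
theorem sdepth_quotient_edgeIdeal_C_n_2_bounds (K : Type) [Field K] (n : ℕ) (hn : 3 ≤ n) :
    (n - 1 + 2) / 3 ≤ sdepth K (Fin n × Fin 2)
        (MvPolynomial (Fin n × Fin 2) K ⧸ edgeIdeal K (cAdj n 2)) ∧
    sdepth K (Fin n × Fin 2)
        (MvPolynomial (Fin n × Fin 2) K ⧸ edgeIdeal K (cAdj n 2)) ≤ (n + 2) / 3 := by
  have hirr : ∀ a, ¬ cAdj n 2 a a := fun a h => h.1 rfl
  obtain ⟨D, hD, hmax, hcard⟩ := exists_facet n hn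
  have hub : ∀ d ∈ { d | ∃ r, ∃ w : Fin r →
      (MvPolynomial (Fin n × Fin 2) K ⧸ edgeIdeal K (cAdj n 2)),
      ∃ A : Fin r → Finset (Fin n × Fin 2),
      IsStanleyDecomp K (Fin n × Fin 2) _ w A ∧
        d = sInf (Set.range fun i => (A i).card) }, d ≤ (n + 2) / 3 := by
    rintro d ⟨r, w, A, hdec, rfl⟩
    obtain ⟨i, hi⟩ := exists_small_of_facet K (cAdj n 2) hirr D hD hmax w A hdec
    exact (Nat.sInf_le (Set.mem_range_self i)).trans (hi.trans hcard)
  obtain ⟨r, w, A, hdec, hle⟩ :=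
    exists_decomp_of_part K (cAdj n 2) hirr _ (cycle_part n hn)
  constructor
  · exact hle.trans (le_csSup ⟨_, hub⟩ ⟨r, w, A, hdec, rfl⟩)
  · exact csSup_le ⟨_, r, w, A, hdec, rfl⟩ hub
end

section
/- For every integer n ≥ 2, depth(S*_{n,3}/I(P*_{n,3})) = sdepth(S*_{n,3}/I(P*_{n,3})) = ⌈(n+1)/3⌉. -/
open MvPolynomial

/-- Adjacency in the graph `P*_{n,3}`: the strong product `Pₙ ⊠ P₃` together with one extra
vertex `z_{n+1}` adjacent exactly to `z_n = (n-1, 2)` and `y_n = (n-1, 1)` (0-indexed). -/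
def pStarAdj (n : ℕ) (a b : (Fin n × Fin 3) ⊕ Unit) : Prop :=
  (∃ a' b', a = Sum.inl a' ∧ b = Sum.inl b' ∧ pAdj n 3 a' b') ∨
  (∃ a', (a = Sum.inl a' ∧ b = Sum.inr () ∨ a = Sum.inr () ∧ b = Sum.inl a') ∧
    (a'.1 : ℕ) = n - 1 ∧ ((a'.2 : ℕ) = 1 ∨ (a'.2 : ℕ) = 2))


/-! ### Depth is bounded by the dimension at an associated prime -/

open Pointwise in
lemma ass_step {R : Type*} [CommRing R] [IsNoetherianRing R] {M : Type*} [AddCommGroup M]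
    [Module R M] [Module.Finite R M] {P m : Ideal R} [hm : m.IsPrime]
    (hP : IsAssociatedPrime P M) (hPm : P ≤ m) {x : R} (hx : x ∈ m) (hreg : IsSMulRegular M x) :
    ∃ Q : Ideal R, IsAssociatedPrime Q (QuotSMulTop x M) ∧ P < Q ∧ Q ≤ m := by
  obtain ⟨hPp, u, hu⟩ := isAssociatedPrime_iff.1 hP
  have hmem : ∀ r, r ∈ P ↔ r • u = 0 := by
    intro r
    rw [hu, Submodule.mem_colon_singleton, Submodule.mem_bot]
  let N : Submodule R M := Submodule.torsionBySet R M (P : Set R)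
  have hN : ∀ y, y ∈ N ↔ ∀ p ∈ P, p • y = 0 := by
    intro y
    simp [N, Submodule.mem_torsionBySet_iff]
  have huN : u ∈ N := (hN u).2 fun p hp => (hmem p).1 hp
  have hsupp : (⟨m, hm⟩ : PrimeSpectrum R) ∈ Module.support R N := by
    rw [Module.mem_support_iff_of_finite]
    intro r hr
    refine hPm ((hmem r).2 ?_)
    have := Module.mem_annihilator.1 hr ⟨u, huN⟩
    exact congrArg Subtype.val this
  have hsupp2 : (⟨m, hm⟩ : PrimeSpectrum R) ∈ Module.support R (QuotSMulTop x N) := by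
    rw [Module.support_quotSMulTop]
    exact ⟨hsupp, by simpa using hx⟩
  rw [Module.mem_support_iff_of_finite] at hsupp2
  obtain ⟨Q, hQ, hQm⟩ := Ideal.exists_minimalPrimes_le hsupp2
  have hQass := Module.associatedPrimes.minimalPrimes_annihilator_subset_associatedPrimes R
    (QuotSMulTop x N) hQ
  have hann : Module.annihilator R (QuotSMulTop x N) ≤ Q := hQ.1.2
  have hxQ : x ∈ Q := hann (QuotSMulTop.mem_annihilator _ x)
  have hPQ : P ≤ Q := by
    refine le_trans ?_ hann
    intro p hp
    rw [Module.mem_annihilator]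
    intro y
    obtain ⟨y, rfl⟩ := Submodule.Quotient.mk_surjective _ y
    rw [← Submodule.Quotient.mk_smul]
    have : p • y = 0 := Subtype.ext ((hN _).1 y.2 p hp)
    rw [this, Submodule.Quotient.mk_zero]
  have hu0 : u ≠ 0 := by
    rintro rfl
    exact hPp.ne_top ((Ideal.eq_top_iff_one _).2 ((hmem 1).2 (by simp)))
  have hxP : x ∉ P := by
    intro h
    have h1 := (hmem x).1 h
    exact hu0 (hreg (by simpa using h1))
  refine ⟨Q, ?_, lt_of_le_of_ne hPQ (fun h => hxP (h ▸ hxQ)), hQm⟩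
  refine IsAssociatedPrime.map_of_injective (QuotSMulTop.map x N.subtype) hQass ?_
  rw [injective_iff_map_eq_zero]
  intro y hy
  obtain ⟨y, rfl⟩ := Submodule.Quotient.mk_surjective _ y
  rw [QuotSMulTop.map_apply_mk, Submodule.Quotient.mk_eq_zero] at hy
  rw [Submodule.Quotient.mk_eq_zero]
  obtain ⟨z, -, hz⟩ := (Submodule.mem_smul_pointwise_iff_exists _ _ _).1 hy
  have hzN : z ∈ N := by
    rw [hN]
    intro p hp
    have h1 := (hN _).1 y.2 p hp
    apply hreg
    simp only [smul_zero]
    rw [smul_comm, hz]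
    exact h1
  refine (Submodule.mem_smul_pointwise_iff_exists _ _ _).2 ⟨⟨z, hzN⟩, trivial, Subtype.ext hz⟩

open RingTheory.Sequence in
lemma length_le_coheight_ass {R : Type*} [CommRing R] [IsNoetherianRing R] {m : Ideal R}
    [hm : m.IsPrime] (rs : List R) : ∀ {M : Type _} [AddCommGroup M] [Module R M]
    [Module.Finite R M] {P : Ideal R} (hP : IsAssociatedPrime P M) (_ : P ≤ m)
    (_ : ∀ r ∈ rs, r ∈ m) (_ : IsWeaklyRegular M rs),
    (rs.length : ℕ∞) ≤ Order.coheight (⟨P, hP.isPrime⟩ : PrimeSpectrum R) := by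
  induction rs with
  | nil => intros; simp
  | cons r rs ih =>
    intro M _ _ _ P hP hPm hrs hreg
    rw [isWeaklyRegular_cons_iff] at hreg
    obtain ⟨Q, hQ, hPQ, hQm⟩ := ass_step hP hPm (hrs r (by simp)) hreg.1
    have h1 := ih hQ hQm (fun s hs => hrs s (by simp [hs])) hreg.2
    have h2 : (⟨P, hP.isPrime⟩ : PrimeSpectrum R) < ⟨Q, hQ.isPrime⟩ := hPQ
    refine le_trans ?_ (Order.coheight_add_one_le h2)
    simp only [List.length_cons, Nat.cast_add, Nat.cast_one]
    gcongr

lemma coheight_le_ringKrullDim_quotient {R : Type*} [CommRing R] (P : Ideal R) (hP : P.IsPrime) :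
    (Order.coheight (⟨P, hP⟩ : PrimeSpectrum R) : WithBot ℕ∞) ≤ ringKrullDim (R ⧸ P) := by
  rw [ringKrullDim_quotient, Order.coheight_eq_krullDim_Ici]
  exact le_of_eq rfl

/-! ### Elementwise weakly regular sequences -/

/-- `rs` is weakly regular on `R ⧸ J`, elementwise. -/
def WR {R : Type*} [CommRing R] : Ideal R → List R → Prop
  | _, [] => True
  | J, r :: rs => (∀ f, r * f ∈ J → f ∈ J) ∧ WR (J ⊔ Ideal.span {r}) rs

lemma WR_ses {R : Type*} [CommRing R] (x : R) (rs : List R) : ∀ A B C : Ideal R,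
    (∀ f, f ∈ A ↔ x * f ∈ B) → C = B ⊔ Ideal.span {x} → WR A rs → WR C rs → WR B rs := by
  induction rs with
  | nil => intros; trivial
  | cons r rs ih =>
    intro A B C hA hC hWA hWC
    have hCmem : ∀ f, f ∈ C ↔ ∃ b ∈ B, ∃ g, f = b + x * g := by
      intro f
      rw [hC, Submodule.mem_sup]
      constructor
      · rintro ⟨b, hb, z, hz, rfl⟩
        obtain ⟨g, rfl⟩ := Ideal.mem_span_singleton'.1 hz
        exact ⟨b, hb, g, by ring⟩
      · rintro ⟨b, hb, g, rfl⟩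
        exact ⟨b, hb, x * g, Ideal.mul_mem_right _ _ (Ideal.mem_span_singleton_self x), rfl⟩
    refine ⟨?_, ih (A ⊔ Ideal.span {r}) (B ⊔ Ideal.span {r}) (C ⊔ Ideal.span {r}) ?_ ?_
      hWA.2 hWC.2⟩
    · intro f hf
      have h1 : r * f ∈ C := (hCmem _).2 ⟨_, hf, 0, by ring⟩
      obtain ⟨b, hb, g, rfl⟩ := (hCmem _).1 (hWC.1 f h1)
      have h2 : x * (r * g) ∈ B := by
        have := B.sub_mem hf (B.mul_mem_left r hb)
        convert this using 1
        ring
      exact B.add_mem hb ((hA g).1 (hWA.1 g ((hA _).2 h2)))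
    · intro f
      rw [Submodule.mem_sup, Submodule.mem_sup]
      constructor
      · rintro ⟨a, ha, z, hz, rfl⟩
        exact ⟨x * a, (hA a).1 ha, x * z, Ideal.mul_mem_left _ _ hz, by ring⟩
      · rintro ⟨b, hb, z, hz, h⟩
        obtain ⟨q, rfl⟩ := Ideal.mem_span_singleton'.1 hz
        have h1 : r * q ∈ C := (hCmem _).2 ⟨-b, B.neg_mem hb, f, by linear_combination h⟩
        obtain ⟨b', hb', g, rfl⟩ := (hCmem _).1 (hWC.1 q h1)
        refine ⟨f - r * g, (hA _).2 ?_, r * g,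
          Ideal.mul_mem_right _ _ (Ideal.mem_span_singleton_self r), by ring⟩
        have h2 := B.add_mem hb (B.mul_mem_left r hb')
        convert h2 using 1
        linear_combination -h
    · rw [hC, sup_assoc, sup_assoc, sup_comm (Ideal.span {x})]

lemma WR_of_take {R : Type*} [CommRing R] (rs : List R) : ∀ J : Ideal R,
    (∀ i (h : i < rs.length), ∀ f, rs[i] * f ∈ J ⊔ Ideal.ofList (rs.take i) →
      f ∈ J ⊔ Ideal.ofList (rs.take i)) → WR J rs := by
  induction rs with
  | nil => intros; trivial
  | cons r rs ih =>
    intro J h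
    refine ⟨fun f hf => by simpa using h 0 (by simp) f (by simpa using hf), ih _ ?_⟩
    intro i hi f hf
    have := h (i + 1) (by simpa using hi) f
    simp only [List.getElem_cons_succ, List.take_succ_cons, Ideal.ofList_cons, ← sup_assoc] at this
    exact this hf

open RingTheory.Sequence Pointwise in
lemma WR.isWeaklyRegular {R : Type*} [CommRing R] (rs : List R) : ∀ J : Ideal R,
    WR J rs → IsWeaklyRegular (R ⧸ J) rs := by
  induction rs with
  | nil => intros; simp
  | cons r rs ih =>
    intro J h
    rw [isWeaklyRegular_cons_iff]
    constructor
    · rw [isSMulRegular_iff_right_eq_zero_of_smul]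
      intro y hy
      obtain ⟨f, rfl⟩ := Ideal.Quotient.mk_surjective y
      rw [Algebra.smul_def, Ideal.Quotient.algebraMap_eq, ← map_mul,
        Ideal.Quotient.eq_zero_iff_mem] at hy
      exact Ideal.Quotient.eq_zero_iff_mem.2 (h.1 f hy)
    · let φ : R →ₗ[R] QuotSMulTop r (R ⧸ J) := (Submodule.mkQ _).comp (Submodule.mkQ J)
      have hφ : Function.Surjective φ :=
        (Submodule.mkQ_surjective _).comp (Submodule.mkQ_surjective J)
      have hker : LinearMap.ker φ = J ⊔ Ideal.span {r} := by
        ext f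
        rw [LinearMap.mem_ker, Submodule.mem_sup]
        simp only [φ, LinearMap.comp_apply, Submodule.mkQ_apply]
        rw [Submodule.Quotient.mk_eq_zero, Submodule.mem_smul_pointwise_iff_exists]
        constructor
        · rintro ⟨y, -, hy⟩
          obtain ⟨g, rfl⟩ := Submodule.Quotient.mk_surjective _ y
          rw [← Submodule.Quotient.mk_smul, Submodule.Quotient.eq] at hy
          refine ⟨f - r • g, ?_, r • g, ?_, by ring⟩
          · have := J.neg_mem hy
            rwa [neg_sub] at this
          · exact Ideal.mul_mem_right _ _ (Ideal.mem_span_singleton_self r)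
        · rintro ⟨a, ha, z, hz, rfl⟩
          obtain ⟨g, rfl⟩ := Ideal.mem_span_singleton'.1 hz
          refine ⟨Submodule.Quotient.mk g, trivial, ?_⟩
          rw [← Submodule.Quotient.mk_smul, Submodule.Quotient.eq]
          have : r • g - (a + g * r) = - a := by simp only [smul_eq_mul]; ring
          rw [this]
          exact J.neg_mem ha
      have e1 : (R ⧸ (J ⊔ Ideal.span {r})) ≃ₗ[R] QuotSMulTop r (R ⧸ J) :=
        (Submodule.quotEquivOfEq _ _ hker.symm).trans (φ.quotKerEquivOfSurjective hφ)
      exact (e1.isWeaklyRegular_congr rs).1 (ih _ h.2)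

/-! ### Faces and the ideals `faceIdeal` -/

/-- `m` is supported on an independent subset of `W`. -/
def Face {V : Type} (Adj : V → V → Prop) (W : Finset V) (m : V →₀ ℕ) : Prop :=
  (∀ v, m v ≠ 0 → v ∈ W) ∧ ∀ a b, m a ≠ 0 → m b ≠ 0 → ¬ Adj a b

lemma Face.mono {V : Type} {Adj : V → V → Prop} {W : Finset V} {m m' : V →₀ ℕ}
    (h : Face Adj W m) (hm : ∀ v, m' v ≠ 0 → m v ≠ 0) : Face Adj W m' :=
  ⟨fun v hv => h.1 v (hm v hv), fun a b ha hb => h.2 a b (hm a ha) (hm b hb)⟩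

lemma Face.of_le {V : Type} {Adj : V → V → Prop} {W : Finset V} {m m' : V →₀ ℕ}
    (h : Face Adj W m) (hm : m' ≤ m) : Face Adj W m' :=
  h.mono fun v hv h0 => hv (Nat.le_zero.1 (h0 ▸ hm v))

/-- The ideal spanned by all monomials that are not faces. -/
noncomputable def faceIdeal (K : Type) [Field K] {V : Type} (Adj : V → V → Prop) (W : Finset V) :
    Ideal (MvPolynomial V K) :=
  Ideal.span ((fun m => monomial m (1 : K)) '' {m | ¬ Face Adj W m})

lemma mem_faceIdeal {K : Type} [Field K] {V : Type} {Adj : V → V → Prop} {W : Finset V}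
    {f : MvPolynomial V K} :
    f ∈ faceIdeal K Adj W ↔ ∀ m, Face Adj W m → coeff m f = 0 := by
  rw [faceIdeal, mem_ideal_span_monomial_image]
  constructor
  · intro h m hm
    by_contra h0
    obtain ⟨s, hs, hsm⟩ := h m (mem_support_iff.2 h0)
    exact hs (hm.of_le hsm)
  · intro h m hm
    exact ⟨m, fun hF => mem_support_iff.1 hm (h m hF), le_rfl⟩

lemma edgeIdeal_eq_faceIdeal (K : Type) [Field K] {V : Type} [Fintype V] (Adj : V → V → Prop)
    (hirr : ∀ a, ¬ Adj a a) :
    edgeIdeal K Adj = faceIdeal K Adj Finset.univ := by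
  classical
  have h1 : edgeIdeal K Adj = Ideal.span ((fun m => monomial m (1 : K)) ''
      {m | ∃ a b : V, Adj a b ∧ m = Finsupp.single a 1 + Finsupp.single b 1}) := by
    rw [edgeIdeal]
    congr 1
    ext p
    simp only [Set.mem_ofPred_eq, Set.mem_image]
    constructor
    · rintro ⟨a, b, hab, rfl⟩
      exact ⟨_, ⟨a, b, hab, rfl⟩, by simp [X, monomial_mul]⟩
    · rintro ⟨_, ⟨a, b, hab, rfl⟩, rfl⟩
      exact ⟨a, b, hab, by simp [X, monomial_mul]⟩
  ext f
  rw [h1, mem_ideal_span_monomial_image, mem_faceIdeal]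
  constructor
  · intro h m hm
    by_contra h0
    obtain ⟨s, ⟨a, b, hab, rfl⟩, hsm⟩ := h m (mem_support_iff.2 h0)
    have ha := hsm a
    have hb := hsm b
    simp at ha hb
    exact hm.2 a b (by omega) (by omega) hab
  · intro h m hm
    have hnf : ¬ Face Adj Finset.univ m := fun hF => mem_support_iff.1 hm (h m hF)
    simp only [Face, Finset.mem_univ, implies_true, true_and, not_forall, not_not] at hnf
    obtain ⟨a, b, ha, hb, hab⟩ := hnf
    refine ⟨_, ⟨a, b, hab, rfl⟩, ?_⟩
    have hne : a ≠ b := by rintro rfl; exact hirr a hab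
    intro v
    simp only [Finsupp.add_apply, Finsupp.single_apply]
    split_ifs with h1 h2 h2
    · exact absurd (h1.trans h2.symm) hne
    · subst h1; omega
    · subst h2; omega
    · omega

lemma face_add_single {V : Type} [DecidableEq V] {Adj : V → V → Prop} [DecidableRel Adj]
    (hirr : ∀ a, ¬ Adj a a)
    (hsymm : ∀ a b, Adj a b → Adj b a) {W : Finset V} {u : V} (hu : u ∈ W) (m : V →₀ ℕ) :
    Face Adj W (m + Finsupp.single u 1) ↔ Face Adj (W.filter fun v => ¬ Adj u v) m := by
  have key : ∀ v, (m + Finsupp.single u 1 : V →₀ ℕ) v ≠ 0 ↔ m v ≠ 0 ∨ v = u := by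
    intro v
    simp only [Finsupp.add_apply, Finsupp.single_apply]
    split_ifs with h
    · simp [h]
    · simp [Ne.symm h]
  simp only [Face, key, Finset.mem_filter]
  constructor
  · rintro ⟨h1, h2⟩
    exact ⟨fun v hv => ⟨h1 v (.inl hv), h2 u v (.inr rfl) (.inl hv)⟩,
      fun a b ha hb => h2 a b (.inl ha) (.inl hb)⟩
  · rintro ⟨h1, h2⟩
    refine ⟨?_, ?_⟩
    · rintro v (hv | rfl)
      · exact (h1 v hv).1
      · exact hu
    · rintro a b (ha | rfl) (hb | rfl)
      · exact h2 a b ha hb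
      · exact fun h => (h1 a ha).2 (hsymm _ _ h)
      · exact (h1 b hb).2
      · exact hirr _

lemma X_mul_mem_faceIdeal {K : Type} [Field K] {V : Type} [DecidableEq V] {Adj : V → V → Prop}
    [DecidableRel Adj] (hirr : ∀ a, ¬ Adj a a)
    (hsymm : ∀ a b, Adj a b → Adj b a) {W : Finset V} {u : V} (hu : u ∈ W)
    (f : MvPolynomial V K) :
    f ∈ faceIdeal K Adj (W.filter fun v => ¬ Adj u v) ↔ X u * f ∈ faceIdeal K Adj W := by
  rw [mem_faceIdeal, mem_faceIdeal]
  constructor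
  · intro h m hm
    rw [coeff_X_mul']
    split_ifs with hmu
    · apply h
      rw [← face_add_single hirr hsymm hu]
      convert hm
      rw [tsub_add_cancel_of_le]
      simpa [Nat.one_le_iff_ne_zero] using hmu
    · rfl
  · intro h m hm
    rw [← coeff_X_mul m u f]
    apply h
    rw [add_comm]
    exact (face_add_single hirr hsymm hu m).2 hm

lemma face_erase {V : Type} [DecidableEq V] {Adj : V → V → Prop} {W : Finset V} {u : V}
    (m : V →₀ ℕ) : Face Adj (W.erase u) m ↔ Face Adj W m ∧ m u = 0 := by
  simp only [Face, Finset.mem_erase]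
  constructor
  · rintro ⟨h1, h2⟩
    refine ⟨⟨fun v hv => (h1 v hv).2, h2⟩, ?_⟩
    by_contra h
    exact (h1 u h).1 rfl
  · rintro ⟨⟨h1, h2⟩, h3⟩
    refine ⟨fun v hv => ⟨?_, h1 v hv⟩, h2⟩
    rintro rfl
    exact hv h3

lemma faceIdeal_erase {K : Type} [Field K] {V : Type} [DecidableEq V] {Adj : V → V → Prop}
    {W : Finset V} {u : V} :
    faceIdeal K Adj (W.erase u) = faceIdeal K Adj W ⊔ Ideal.span {X u} := by
  apply le_antisymm
  · rw [faceIdeal, Ideal.span_le]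
    rintro _ ⟨m, hm, rfl⟩
    simp only [Set.mem_ofPred_eq, face_erase, not_and] at hm
    by_cases hF : Face Adj W m
    · have h1 : m = (m - Finsupp.single u 1) + Finsupp.single u 1 := by
        rw [tsub_add_cancel_of_le]
        simpa [Nat.one_le_iff_ne_zero] using hm hF
      refine Ideal.mem_sup_right ?_
      have h2 : (monomial m (1 : K)) = monomial (m - Finsupp.single u 1) (1 : K) * X u := by
        rw [X, monomial_mul, ← h1, one_mul]
      simp only [h2]
      exact Ideal.mul_mem_left _ _ (Ideal.mem_span_singleton_self _)
    · exact Ideal.mem_sup_left (Ideal.subset_span ⟨m, hF, rfl⟩)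
  · refine sup_le (fun f hf => ?_) ?_
    · rw [mem_faceIdeal] at hf ⊢
      exact fun m hm => hf m ((face_erase m).1 hm).1
    · rw [Ideal.span_singleton_le_iff_mem, mem_faceIdeal]
      intro m hm
      rw [coeff_X, if_neg]
      rintro rfl
      have := ((face_erase _).1 hm).2
      simp at this

/-! ### The splitting induction -/

/-- Every label below `d` has a centre in `W`: all neighbours in `W` carry the same label. -/
def Centered {V : Type} (Adj : V → V → Prop) (lab : V → ℕ) (d : ℕ) (W : Finset V) : Prop :=
  ∀ k < d, ∃ c ∈ W, lab c = k ∧ ∀ v ∈ W, Adj c v → lab v = k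

lemma split_induction {V : Type} [DecidableEq V] {Adj : V → V → Prop} [DecidableRel Adj]
    (hirr : ∀ a, ¬ Adj a a)
    (hsymm : ∀ a b, Adj a b → Adj b a) {lab : V → ℕ} {d : ℕ} {motive : Finset V → Prop}
    (base : ∀ W, Centered Adj lab d W → (∀ a ∈ W, ∀ b ∈ W, ¬ Adj a b) → motive W)
    (step : ∀ W, ∀ u ∈ W, motive (W.filter fun v => ¬ Adj u v) → motive (W.erase u) → motive W) :
    ∀ N : ℕ, ∀ W : Finset V, W.card = N → Centered Adj lab d W → motive W := by
  intro N
  induction N using Nat.strong_induction_on with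
  | _ N ih =>
    intro W hW hC
    by_cases hE : ∀ a ∈ W, ∀ b ∈ W, ¬ Adj a b
    · exact base W hC hE
    push Not at hE
    obtain ⟨a, ha, b, hb, hab⟩ := hE
    have hC' := hC
    choose c hcW hcl hcN using hC
    -- a non-central vertex with a neighbour
    obtain ⟨u, huW, w, hwW, huw, hunc⟩ : ∃ u ∈ W, ∃ w ∈ W, Adj u w ∧ ∀ l hl, c l hl ≠ u := by
      by_cases hac : ∀ l hl, c l hl ≠ a
      · exact ⟨a, ha, b, hb, hab, hac⟩
      push Not at hac
      obtain ⟨l, hl, rfl⟩ := hac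
      refine ⟨b, hb, _, ha, hsymm _ _ hab, ?_⟩
      rintro l' hl' rfl
      have h1 := hcN l hl _ hb hab
      rw [hcl l' hl'] at h1
      subst h1
      exact hirr _ hab
    apply step W u huW
    · refine ih _ ?_ _ rfl ?_
      · rw [← hW]
        apply Finset.card_lt_card
        rw [Finset.filter_ssubset]
        exact ⟨w, hwW, by simpa using huw⟩
      · intro k hk
        by_cases hadj : Adj u (c k hk)
        · refine ⟨u, by simp [huW, hirr], hcN k hk u huW (hsymm _ _ hadj), ?_⟩
          intro v hv huv
          exact absurd huv (Finset.mem_filter.1 hv).2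
        · exact ⟨c k hk, by simp [hcW, hadj], hcl k hk, fun v hv =>
            hcN k hk v (Finset.mem_filter.1 hv).1⟩
    · refine ih _ ?_ _ rfl ?_
      · rw [← hW]
        exact Finset.card_erase_lt_of_mem huW
      · intro k hk
        exact ⟨c k hk, Finset.mem_erase.2 ⟨hunc k hk, hcW k hk⟩, hcl k hk, fun v hv =>
          hcN k hk v (Finset.mem_of_mem_erase hv)⟩

/-! ### The regular sequence -/

/-- The sum of all variables with label `k`. -/
noncomputable def labForm (K : Type) [Field K] {V : Type} [Fintype V] (lab : V → ℕ) (k : ℕ) :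
    MvPolynomial V K := ∑ v with lab v = k, X v

lemma WR_base {K : Type} [Field K] {V : Type} [Fintype V] [DecidableEq V] [Nonempty V]
    {Adj : V → V → Prop}
    {lab : V → ℕ} {d : ℕ} {W : Finset V} (hC : Centered Adj lab d W)
    (hE : ∀ a ∈ W, ∀ b ∈ W, ¬ Adj a b) :
    WR (faceIdeal K Adj W) ((List.range d).map (labForm K lab)) := by
  choose! c hcW hcl _ using hC
  apply WR_of_take
  intro k hk f hf
  have hkd : k < d := by simpa using hk
  rw [← List.map_take, List.take_range, min_eq_left hkd.le] at hf ⊢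
  simp only [List.getElem_map, List.getElem_range] at hf
  set I := faceIdeal K Adj W ⊔ Ideal.ofList ((List.range k).map (labForm K lab)) with hI
  let T : ℕ → MvPolynomial V K := fun l => ∑ v with lab v = l, if v ∈ W then X v else 0
  let g : V → MvPolynomial V K := fun v =>
    if v ∈ W then (X v - if c (lab v) = v ∧ lab v < k then T (lab v) else 0) else 0
  let ψ : MvPolynomial V K →ₐ[K] MvPolynomial V K := aeval g
  have hψ : ∀ l < d, ψ (labForm K lab l) = T l - if l < k then T l else 0 := by
    intro l hl
    have h1 : ψ (labForm K lab l) = ∑ v with lab v = l, g v := by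
      simp [ψ, labForm]
    have h2 : ∀ v ∈ Finset.univ.filter (fun v => lab v = l), g v =
        (if v ∈ W then X v else 0) - if c l = v then (if l < k then T l else 0) else 0 := by
      intro v hv
      have hv' : lab v = l := (Finset.mem_filter.1 hv).2
      simp only [g, hv']
      by_cases hvW : v ∈ W
      · simp only [hvW, if_true]
        congr 1
        by_cases h3 : c l = v <;> simp [h3]
      · have h3 : c l ≠ v := by rintro rfl; exact hvW (hcW l hl)
        simp [hvW, h3]
    rw [h1, Finset.sum_congr rfl h2, Finset.sum_sub_distrib, Finset.sum_ite_eq, if_pos]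
    simp [hcl l hl]
  have hXW : ∀ v, v ∉ W → (X v : MvPolynomial V K) ∈ I := by
    intro v hv
    refine Ideal.mem_sup_left (mem_faceIdeal.2 ?_)
    intro m hm
    rw [coeff_X, if_neg]
    rintro rfl
    exact hv (hm.1 v (by simp))
  have hkill : ∀ p ∈ I, ψ p = 0 := by
    have : I ≤ RingHom.ker ψ := by
      rw [hI]
      refine sup_le ?_ ?_
      · rw [faceIdeal, Ideal.span_le]
        rintro _ ⟨m, hm, rfl⟩
        have : ∃ v, m v ≠ 0 ∧ v ∉ W := by
          by_contra hcon
          push Not at hcon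
          exact hm ⟨hcon, fun a b ha hb => hE a (hcon a ha) b (hcon b hb)⟩
        obtain ⟨v, hv, hvW⟩ := this
        simp only [SetLike.mem_coe, RingHom.mem_ker]
        simp only [ψ]
        rw [aeval_monomial, Finsupp.prod, Finset.prod_eq_zero (Finsupp.mem_support_iff.2 hv),
          mul_zero]
        simp [g, hvW, hv]
      · rw [Ideal.ofList, Ideal.span_le]
        intro p hp
        simp only [Set.mem_ofPred_eq, List.mem_map, List.mem_range] at hp
        obtain ⟨l, hl, rfl⟩ := hp
        simp only [SetLike.mem_coe, RingHom.mem_ker]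
        rw [hψ l (hl.trans hkd), if_pos hl, sub_self]
    exact fun p hp => this hp
  have hcong : ∀ p, p - ψ p ∈ I := by
    have h1 : (Ideal.Quotient.mkₐ K I) = (Ideal.Quotient.mkₐ K I).comp ψ := by
      apply algHom_ext
      intro v
      simp only [AlgHom.comp_apply, Ideal.Quotient.mkₐ_eq_mk]
      rw [Ideal.Quotient.eq]
      simp only [ψ, aeval_X, g]
      split_ifs with hvW hvc
      · rw [sub_sub_cancel]
        have h2 : T (lab v) = labForm K lab (lab v) -
            ∑ w with lab w = lab v, if w ∈ W then 0 else X w := by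
          rw [labForm, ← Finset.sum_sub_distrib]
          refine Finset.sum_congr rfl fun w _ => ?_
          split_ifs <;> simp
        rw [h2]
        refine I.sub_mem (Ideal.mem_sup_right (Ideal.subset_span ?_)) (I.sum_mem ?_)
        · simp only [Set.mem_ofPred_eq, List.mem_map, List.mem_range]
          exact ⟨_, hvc.2, rfl⟩
        · intro w _
          split_ifs with hw
          · exact I.zero_mem
          · exact hXW w hw
      · simp
      · simpa using hXW v hvW
    intro p
    have := DFunLike.congr_fun h1 p
    simp only [AlgHom.comp_apply, Ideal.Quotient.mkₐ_eq_mk] at this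
    exact Ideal.Quotient.eq.1 this
  have hT : T k ≠ 0 := by
    intro h0
    have h1 := congrArg (eval (fun v => if c k = v then (1 : K) else 0)) h0
    simp only [T, map_sum, map_zero] at h1
    have h2 : ∀ v ∈ Finset.univ.filter (fun v => lab v = k),
        eval (fun v => if c k = v then (1 : K) else 0) (if v ∈ W then X v else 0) =
        if c k = v then 1 else 0 := by
      intro v _
      by_cases h3 : c k = v
      · subst h3; simp [hcW k hkd]
      · split_ifs <;> simp [h3]
    rw [Finset.sum_congr rfl h2, Finset.sum_ite_eq, if_pos (by simp [hcl k hkd])] at h1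
    exact one_ne_zero h1
  have h1 := hkill _ hf
  rw [map_mul, hψ k hkd, if_neg (lt_irrefl k), sub_zero] at h1
  have h2 := (mul_eq_zero.1 h1).resolve_left hT
  have h3 := hcong f
  rwa [h2, sub_zero] at h3

lemma WR_faceIdeal {K : Type} [Field K] {V : Type} [Fintype V] [DecidableEq V] [Nonempty V]
    {Adj : V → V → Prop} (hirr : ∀ a, ¬ Adj a a)
    (hsymm : ∀ a b, Adj a b → Adj b a) {lab : V → ℕ} {d : ℕ} {W : Finset V}
    (hC : Centered Adj lab d W) :
    WR (faceIdeal K Adj W) ((List.range d).map (labForm K lab)) := by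
  classical
  refine split_induction hirr hsymm
    (motive := fun W => WR (faceIdeal K Adj W) ((List.range d).map (labForm K lab)))
    (fun W => WR_base) ?_ _ W rfl hC
  intro W u hu h1 h2
  exact WR_ses (X u) _ _ _ _ (X_mul_mem_faceIdeal hirr hsymm hu) faceIdeal_erase h1 h2

/-! ### The Stanley decomposition, combinatorially -/

lemma exists_partition {V : Type} [DecidableEq V]
    {Adj : V → V → Prop} (hirr : ∀ a, ¬ Adj a a)
    (hsymm : ∀ a b, Adj a b → Adj b a) {lab : V → ℕ} {d : ℕ} {W : Finset V}
    (hC : Centered Adj lab d W) :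
    ∃ (ι : Type) (_ : Fintype ι) (w : ι → V →₀ ℕ) (A : ι → Finset V),
      (∀ i u, u.support ⊆ A i → Face Adj W (w i + u)) ∧
      (∀ m, Face Adj W m → ∃ i u, u.support ⊆ A i ∧ m = w i + u) ∧
      (∀ i j u v, u.support ⊆ A i → v.support ⊆ A j → w i + u = w j + v → i = j) ∧
      ∀ i, d ≤ (A i).card := by
  classical
  refine split_induction hirr hsymm (lab := lab) (d := d)
    (motive := fun W => ∃ (ι : Type) (_ : Fintype ι) (w : ι → V →₀ ℕ) (A : ι → Finset V),
      (∀ i u, u.support ⊆ A i → Face Adj W (w i + u)) ∧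
      (∀ m, Face Adj W m → ∃ i u, u.support ⊆ A i ∧ m = w i + u) ∧
      (∀ i j u v, u.support ⊆ A i → v.support ⊆ A j → w i + u = w j + v → i = j) ∧
      ∀ i, d ≤ (A i).card) ?_ ?_ _ W rfl hC
  · intro W hC hE
    refine ⟨Unit, inferInstance, fun _ => 0, fun _ => W, ?_, ?_, fun _ _ _ _ _ _ _ => rfl, ?_⟩
    · intro _ u hu
      have hu' : ∀ v, (0 + u) v ≠ 0 → v ∈ W := fun v hv => hu (by simpa using hv)
      exact ⟨hu', fun a b ha hb => hE a (hu' a ha) b (hu' b hb)⟩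
    · intro m hm
      exact ⟨(), m, fun v hv => hm.1 v (Finsupp.mem_support_iff.1 hv), by simp⟩
    · intro _
      have : Finset.range d ⊆ W.image lab := by
        intro k hk
        obtain ⟨c, hc, hck, -⟩ := hC k (Finset.mem_range.1 hk)
        exact Finset.mem_image.2 ⟨c, hc, hck⟩
      have h1 := Finset.card_le_card this
      rw [Finset.card_range] at h1
      exact h1.trans Finset.card_image_le
  · rintro W u hu ⟨ι₁, _, w₁, A₁, ha₁, hb₁, hc₁, hd₁⟩ ⟨ι₂, _, w₂, A₂, ha₂, hb₂, hc₂, hd₂⟩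
    refine ⟨ι₁ ⊕ ι₂, inferInstance, Sum.elim (fun i => w₁ i + Finsupp.single u 1) w₂,
      Sum.elim A₁ A₂, ?_, ?_, ?_, ?_⟩
    · rintro (i | i) t ht
      · have := (face_add_single hirr hsymm hu _).2 (ha₁ i t ht)
        simp only [Sum.elim_inl]
        rwa [add_right_comm]
      · exact ((face_erase _).1 (ha₂ i t ht)).1
    · intro m hm
      by_cases h0 : m u = 0
      · obtain ⟨i, t, ht, rfl⟩ := hb₂ m ((face_erase _).2 ⟨hm, h0⟩)
        exact ⟨.inr i, t, ht, rfl⟩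
      · have h1 : m = (m - Finsupp.single u 1) + Finsupp.single u 1 := by
          rw [tsub_add_cancel_of_le]
          simpa [Nat.one_le_iff_ne_zero] using h0
        rw [h1] at hm
        obtain ⟨i, t, ht, hmt⟩ := hb₁ _ ((face_add_single hirr hsymm hu _).1 hm)
        refine ⟨.inl i, t, ht, ?_⟩
        rw [h1, hmt, Sum.elim_inl, add_right_comm]
    · have hne : ∀ i j s t, t.support ⊆ A₂ j → w₁ i + Finsupp.single u 1 + s ≠ w₂ j + t := by
        intro i j s t ht h
        have h1 := ((face_erase _).1 (ha₂ j t ht)).2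
        rw [← h] at h1
        simp at h1
      rintro (i | i) (j | j) s t hs ht hst
      · simp only [Sum.elim_inl] at hst
        rw [add_right_comm, add_right_comm (w₁ j)] at hst
        rw [hc₁ i j s t hs ht (add_right_cancel hst)]
      · exact absurd hst (hne i j s t ht)
      · exact absurd hst.symm (hne j i t s hs)
      · rw [hc₂ i j s t hs ht hst]
    · rintro (i | i)
      · exact hd₁ i
      · exact hd₂ i

/-! ### Depth: general graph statement -/

lemma isAssociatedPrime_of_maximal {K : Type} [Field K] {V : Type} [Fintype V] [DecidableEq V]
    {Adj : V → V → Prop} {F : Finset V} (hF : ∀ a ∈ F, ∀ b ∈ F, ¬ Adj a b)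
    (hsymm : ∀ a b, Adj a b → Adj b a)
    (hmax : ∀ v ∉ F, ∃ a ∈ F, Adj a v) :
    IsAssociatedPrime (Ideal.span ((X : V → MvPolynomial V K) '' {v | v ∉ F}))
      (MvPolynomial V K ⧸ faceIdeal K Adj Finset.univ) := by
  rw [isAssociatedPrime_iff]
  constructor
  · let ψ : MvPolynomial V K →ₐ[K] MvPolynomial V K := aeval (fun v => if v ∈ F then X v else 0)
    have : Ideal.span ((X : V → MvPolynomial V K) '' {v | v ∉ F}) = RingHom.ker ψ := by
      set I := Ideal.span ((X : V → MvPolynomial V K) '' {v | v ∉ F})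
      apply le_antisymm
      · rw [Ideal.span_le]
        rintro _ ⟨v, hv, rfl⟩
        have hv' : v ∉ F := hv
        simp [ψ, RingHom.mem_ker, hv']
      · have h1 : (Ideal.Quotient.mkₐ K I) = (Ideal.Quotient.mkₐ K I).comp ψ := by
          apply algHom_ext
          intro v
          simp only [AlgHom.comp_apply, Ideal.Quotient.mkₐ_eq_mk]
          rw [Ideal.Quotient.eq]
          simp only [ψ, aeval_X]
          split_ifs with hv
          · simp
          · rw [sub_zero]
            exact Ideal.subset_span ⟨v, hv, rfl⟩
        intro p hp
        have h2 := DFunLike.congr_fun h1 p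
        rw [RingHom.mem_ker] at hp
        simp only [AlgHom.comp_apply, Ideal.Quotient.mkₐ_eq_mk] at h2
        rw [show ψ p = 0 from hp, map_zero] at h2
        exact Ideal.Quotient.eq_zero_iff_mem.1 h2
    rw [this]
    exact RingHom.ker_isPrime _
  · let e : V →₀ ℕ := Finsupp.indicator F (fun _ _ => 1)
    have he : ∀ v, e v = if v ∈ F then 1 else 0 := by
      intro v
      simp [e, Finsupp.indicator_apply]
    refine ⟨Ideal.Quotient.mk _ (monomial e 1), ?_⟩
    ext f
    rw [Submodule.mem_colon_singleton, Submodule.mem_bot]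
    change _ ↔ Ideal.Quotient.mk _ (f * monomial e 1) = 0
    rw [Ideal.Quotient.eq_zero_iff_mem, mem_faceIdeal, mem_ideal_span_X_image]
    constructor
    · intro h m hm
      rw [coeff_mul_monomial']
      split_ifs with hle
      · by_contra h0
        rw [mul_one] at h0
        obtain ⟨v, hv, hv0⟩ := h _ (mem_support_iff.2 h0)
        obtain ⟨a, ha, hav⟩ := hmax v hv
        refine hm.2 a v ?_ ?_ hav
        · have := hle a
          rw [he, if_pos ha] at this
          omega
        · intro h1
          simp [h1] at hv0
      · rfl
    · intro h m hm
      by_contra hcon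
      have hcon' : ∀ v, m v ≠ 0 → v ∈ F := by
        intro v hv
        by_contra hvF
        exact hcon ⟨v, hvF, hv⟩
      have hface : Face Adj Finset.univ (m + e) := by
        have key : ∀ v, (m + e : V →₀ ℕ) v ≠ 0 → v ∈ F := by
          intro v hv
          by_contra hvF
          apply hv
          rw [Finsupp.add_apply, he, if_neg hvF, add_zero]
          by_contra h0
          exact hvF (hcon' v h0)
        exact ⟨fun v _ => Finset.mem_univ v, fun a b ha hb => hF a (key a ha) b (key b hb)⟩
      have := h _ hface
      rw [coeff_mul_monomial, mul_one] at this
      exact mem_support_iff.1 hm this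

lemma ringKrullDim_quotient_span_X_le {K : Type} [Field K] {V : Type} [Fintype V] [DecidableEq V]
    (F : Finset V) :
    ringKrullDim (MvPolynomial V K ⧸ Ideal.span ((X : V → MvPolynomial V K) '' {v | v ∉ F})) ≤
      (F.card : WithBot ℕ∞) := by
  set I := Ideal.span ((X : V → MvPolynomial V K) '' {v | v ∉ F}) with hI
  let φ : MvPolynomial F K →ₐ[K] (MvPolynomial V K ⧸ I) :=
    (Ideal.Quotient.mkₐ K I).comp (rename (fun v : F => (v : V)))
  have hsurj : Function.Surjective φ := by
    rw [← AlgHom.range_eq_top, eq_top_iff]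
    have h1 : (⊤ : Subalgebra K (MvPolynomial V K ⧸ I)) =
        (⊤ : Subalgebra K (MvPolynomial V K)).map (Ideal.Quotient.mkₐ K I) := by
      rw [Algebra.map_top, eq_comm, AlgHom.range_eq_top]
      exact Ideal.Quotient.mkₐ_surjective K I
    rw [h1, ← adjoin_range_X, AlgHom.map_adjoin, Algebra.adjoin_le_iff]
    rintro _ ⟨_, ⟨v, rfl⟩, rfl⟩
    by_cases hv : v ∈ F
    · exact ⟨X ⟨v, hv⟩, by simp [φ]⟩
    · have : (Ideal.Quotient.mkₐ K I) (X v) = 0 := by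
        rw [Ideal.Quotient.mkₐ_eq_mk, Ideal.Quotient.eq_zero_iff_mem]
        exact Ideal.subset_span ⟨v, hv, rfl⟩
      rw [this]
      exact zero_mem _
  refine (ringKrullDim_le_of_surjective φ.toRingHom hsurj).trans ?_
  rw [MvPolynomial.ringKrullDim_of_isNoetherianRing, ringKrullDim_eq_zero_of_field]
  simp

lemma constantCoeff_of_mem_span_X {K : Type} [Field K] {V : Type} {f : MvPolynomial V K}
    (hf : f ∈ Ideal.span (Set.range (X : V → MvPolynomial V K))) : constantCoeff f = 0 := by
  have : Ideal.span (Set.range (X : V → MvPolynomial V K)) ≤ RingHom.ker constantCoeff := by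
    rw [Ideal.span_le]
    rintro _ ⟨v, rfl⟩
    simp [RingHom.mem_ker]
  exact this hf

lemma constantCoeff_of_mem_faceIdeal {K : Type} [Field K] {V : Type} {Adj : V → V → Prop}
    {W : Finset V} {f : MvPolynomial V K} (hf : f ∈ faceIdeal K Adj W) : constantCoeff f = 0 :=
  mem_faceIdeal.1 hf 0 ⟨by simp, by simp⟩

lemma rdepth_eq {K : Type} [Field K] {V : Type} [Fintype V] [DecidableEq V] [Nonempty V]
    {Adj : V → V → Prop} (hirr : ∀ a, ¬ Adj a a)
    (hsymm : ∀ a b, Adj a b → Adj b a) {F : Finset V} (hF : ∀ a ∈ F, ∀ b ∈ F, ¬ Adj a b)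
    (hmax : ∀ v ∉ F, ∃ a ∈ F, Adj a v) {lab : V → ℕ}
    (hC : Centered Adj lab F.card Finset.univ) :
    rdepth K V (MvPolynomial V K ⧸ edgeIdeal K Adj) = F.card := by
  rw [edgeIdeal_eq_faceIdeal K Adj hirr]
  rw [rdepth]
  apply IsGreatest.csSup_eq
  constructor
  · refine ⟨(List.range F.card).map (labForm K lab), by simp, ?_, ?_, ?_⟩
    · intro f hf
      obtain ⟨k, -, rfl⟩ := List.mem_map.1 hf
      exact Ideal.sum_mem _ fun v _ => Ideal.subset_span ⟨v, rfl⟩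
    · exact WR.isWeaklyRegular _ _ (WR_faceIdeal hirr hsymm hC)
    · intro htop
      have hrs : ∀ r ∈ Ideal.ofList ((List.range F.card).map (labForm K lab)),
          constantCoeff r = 0 := by
        have : Ideal.ofList ((List.range F.card).map (labForm K lab)) ≤
            RingHom.ker constantCoeff := by
          rw [Ideal.ofList, Ideal.span_le]
          intro f hf
          obtain ⟨k, -, rfl⟩ := List.mem_map.1 hf
          simp [RingHom.mem_ker, labForm]
        exact fun r hr => this hr
      have key : ∀ y ∈ Ideal.ofList ((List.range F.card).map (labForm K lab)) •
          (⊤ : Submodule (MvPolynomial V K) (MvPolynomial V K ⧸ faceIdeal K Adj Finset.univ)),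
          ∃ f : MvPolynomial V K, Ideal.Quotient.mk _ f = y ∧ constantCoeff f = 0 := by
        intro y hy
        induction hy using Submodule.smul_induction_on' with
        | smul r hr n hn =>
          obtain ⟨g, rfl⟩ := Ideal.Quotient.mk_surjective n
          refine ⟨r * g, by rw [map_mul]; rfl, ?_⟩
          rw [map_mul, hrs r hr, zero_mul]
        | add x hx y hy h1 h2 =>
          obtain ⟨f, rfl, hf⟩ := h1
          obtain ⟨g, rfl, hg⟩ := h2
          exact ⟨f + g, map_add _ _ _, by rw [map_add, hf, hg, add_zero]⟩
      obtain ⟨f, hf1, hf0⟩ := key (Ideal.Quotient.mk _ 1) (htop ▸ Submodule.mem_top)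
      have h1 := constantCoeff_of_mem_faceIdeal (Ideal.Quotient.eq.1 hf1)
      rw [map_sub, hf0, map_one] at h1
      simp at h1
  · rintro _ ⟨rs, rfl, hrs, hreg⟩
    have hass := isAssociatedPrime_of_maximal (K := K) hF hsymm hmax
    have hm : (RingHom.ker (constantCoeff : MvPolynomial V K →+* K)).IsPrime :=
      RingHom.ker_isPrime _
    have h1 := length_le_coheight_ass (m := RingHom.ker (constantCoeff : MvPolynomial V K →+* K))
      rs hass ?_ (fun r hr => constantCoeff_of_mem_span_X (hrs r hr)) hreg.toIsWeaklyRegular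
    · have h2 := coheight_le_ringKrullDim_quotient _ hass.isPrime
      have h3 := h2.trans (ringKrullDim_quotient_span_X_le F)
      have h4 : ((rs.length : ℕ∞) : WithBot ℕ∞) ≤ ((F.card : ℕ∞) : WithBot ℕ∞) :=
        (WithBot.coe_le_coe.2 h1).trans h3
      exact_mod_cast h4
    · rw [Ideal.span_le]
      rintro _ ⟨v, -, rfl⟩
      simp [RingHom.mem_ker]

/-! ### Stanley depth: general graph statement -/

lemma stanley_exists_eq {K : Type} [Field K] {V : Type} [Fintype V] [DecidableEq V]
    {Adj : V → V → Prop} {F : Finset V} (hF : ∀ a ∈ F, ∀ b ∈ F, ¬ Adj a b)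
    (hmax : ∀ v ∉ F, ∃ a ∈ F, Adj a v) {r : ℕ}
    {w : Fin r → MvPolynomial V K ⧸ faceIdeal K Adj Finset.univ} {A : Fin r → Finset V}
    (h : IsStanleyDecomp K V (MvPolynomial V K ⧸ faceIdeal K Adj Finset.univ) w A) :
    ∃ i, A i = F := by
  obtain ⟨hfree, -, htop⟩ := h
  have hex : ∃ i, F ⊆ A i := by
    by_contra hcon
    push Not at hcon
    choose g hg using fun i => Ideal.Quotient.mk_surjective (w i)
    let D := ∑ i, (g i).totalDegree
    let e : V →₀ ℕ := Finsupp.indicator F (fun _ _ => D + 1)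
    have he : ∀ v, e v = if v ∈ F then D + 1 else 0 := by
      intro v
      simp [e, Finsupp.indicator_apply]
    have hface : Face Adj Finset.univ e := by
      have key : ∀ v, e v ≠ 0 → v ∈ F := by
        intro v hv
        by_contra hvF
        exact hv (by rw [he, if_neg hvF])
      exact ⟨fun v _ => Finset.mem_univ v, fun a b ha hb => hF a (key a ha) b (key b hb)⟩
    let T : Submodule K (MvPolynomial V K ⧸ faceIdeal K Adj Finset.univ) :=
      Submodule.map (Ideal.Quotient.mkₐ K (faceIdeal K Adj Finset.univ)).toLinearMap
        (LinearMap.ker (lcoeff K e))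
    have hT : ∀ i, stanleySpace K V _ (w i) (A i) ≤ T := by
      intro i
      rw [stanleySpace, Submodule.span_le]
      rintro _ ⟨u, hu, rfl⟩
      refine ⟨monomial u 1 * g i, ?_, ?_⟩
      · simp only [SetLike.mem_coe, LinearMap.mem_ker, lcoeff_apply]
        rw [coeff_monomial_mul']
        split_ifs with hle
        · by_contra h0
          rw [one_mul] at h0
          obtain ⟨b, hbF, hbA⟩ := Finset.not_subset.1 (hcon i)
          have hub : u b = 0 := by
            by_contra hub
            exact hbA (by exact_mod_cast hu (Finsupp.mem_support_iff.2 hub))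
          have h1 := monomial_le_degreeOf b (mem_support_iff.2 h0)
          have h2 := degreeOf_le_totalDegree (g i) b
          have h3 : (g i).totalDegree ≤ D :=
            Finset.single_le_sum (f := fun i => (g i).totalDegree) (fun _ _ => Nat.zero_le _)
              (Finset.mem_univ i)
          rw [Finsupp.tsub_apply, he, if_pos hbF, hub] at h1
          omega
        · rfl
      · rw [← hg i]
        simp only [AlgHom.toLinearMap_apply, Ideal.Quotient.mkₐ_eq_mk, map_mul]
        rfl
    have h1 : (Ideal.Quotient.mk (faceIdeal K Adj Finset.univ) (monomial e 1)) ∈ T := by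
      have : (⊤ : Submodule K (MvPolynomial V K ⧸ faceIdeal K Adj Finset.univ)) ≤ T := by
        rw [← htop]
        exact iSup_le hT
      exact this trivial
    obtain ⟨f, hf0, hf⟩ := h1
    simp only [SetLike.mem_coe, LinearMap.mem_ker, lcoeff_apply] at hf0
    simp only [AlgHom.toLinearMap_apply, Ideal.Quotient.mkₐ_eq_mk] at hf
    have h2 := mem_faceIdeal.1 (Ideal.Quotient.eq.1 hf) e hface
    rw [coeff_sub, hf0, coeff_monomial, if_pos rfl] at h2
    simp at h2
  obtain ⟨i, hi⟩ := hex
  refine ⟨i, (Finset.Subset.antisymm hi ?_).symm⟩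
  intro j hj
  by_contra hjF
  obtain ⟨a, ha, haj⟩ := hmax j hjF
  have h1 : (X a * X j : MvPolynomial V K) = 0 := by
    apply hfree i
    · intro v hv
      have hv := vars_mul _ _ hv
      simp only [vars_X, Finset.mem_union, Finset.mem_singleton] at hv
      rcases hv with rfl | rfl
      · exact hi ha
      · exact hj
    · obtain ⟨g, hg⟩ := Ideal.Quotient.mk_surjective (w i)
      rw [← hg]
      change Ideal.Quotient.mk _ (X a * X j * g) = 0
      rw [Ideal.Quotient.eq_zero_iff_mem]
      apply Ideal.mul_mem_right
      rw [mem_faceIdeal]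
      intro m hm
      rw [X, X, monomial_mul, coeff_monomial, if_neg]
      rintro rfl
      exact hm.2 a j (by simp) (by simp) haj
  exact mul_ne_zero (X_ne_zero a) (X_ne_zero j) h1

lemma exists_stanley {K : Type} [Field K] {V : Type} [Fintype V] [DecidableEq V]
    {Adj : V → V → Prop} (hirr : ∀ a, ¬ Adj a a)
    (hsymm : ∀ a b, Adj a b → Adj b a) {lab : V → ℕ} {d : ℕ}
    (hC : Centered Adj lab d Finset.univ) :
    ∃ (r : ℕ) (w : Fin r → MvPolynomial V K ⧸ faceIdeal K Adj Finset.univ)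
      (A : Fin r → Finset V),
      IsStanleyDecomp K V (MvPolynomial V K ⧸ faceIdeal K Adj Finset.univ) w A ∧
      ∀ i, d ≤ (A i).card := by
  obtain ⟨ι, _, w', A', ha', hb', hc', hd'⟩ := exists_partition hirr hsymm hC
  obtain ⟨r, w, A, ha, hb, hc, hd⟩ : ∃ (r : ℕ) (w : Fin r → V →₀ ℕ) (A : Fin r → Finset V),
      (∀ i u, u.support ⊆ A i → Face Adj Finset.univ (w i + u)) ∧
      (∀ m, Face Adj Finset.univ m → ∃ i u, u.support ⊆ A i ∧ m = w i + u) ∧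
      (∀ i j u v, u.support ⊆ A i → v.support ⊆ A j → w i + u = w j + v → i = j) ∧
      ∀ i, d ≤ (A i).card := by
    let e := Fintype.equivFin ι
    refine ⟨Fintype.card ι, w' ∘ e.symm, A' ∘ e.symm, fun i => ha' _, ?_, ?_, fun i => hd' _⟩
    · intro m hm
      obtain ⟨i, u, hu, rfl⟩ := hb' m hm
      exact ⟨e i, u, by simpa using hu, by simp⟩
    · intro i j u v hu hv h
      exact e.symm.injective (hc' _ _ u v hu hv h)
  set J := faceIdeal K Adj Finset.univ with hJ
  let b : {m // Face Adj Finset.univ m} → MvPolynomial V K ⧸ J :=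
    fun m => Ideal.Quotient.mk J (monomial m.1 1)
  have hbli : LinearIndependent K b := by
    rw [linearIndependent_iff']
    intro s g hsum i hi
    have h1 : Ideal.Quotient.mk J (∑ i ∈ s, monomial i.1 (g i)) = 0 := by
      rw [← hsum, map_sum]
      refine Finset.sum_congr rfl fun j _ => ?_
      have : (monomial j.1 (g j) : MvPolynomial V K) = g j • monomial j.1 1 := by
        rw [smul_monomial, smul_eq_mul, mul_one]
      rw [this]
      rfl
    rw [Ideal.Quotient.eq_zero_iff_mem, hJ, mem_faceIdeal] at h1
    have h2 := h1 i.1 i.2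
    rw [coeff_sum, Finset.sum_eq_single i] at h2
    · simpa using h2
    · intro j _ hj
      rw [coeff_monomial, if_neg]
      exact fun h => hj (Subtype.ext h)
    · exact fun h => absurd hi h
  let T : Fin r → Set {m // Face Adj Finset.univ m} :=
    fun i => {m | ∃ u : V →₀ ℕ, u.support ⊆ A i ∧ m.1 = w i + u}
  have hst : ∀ i, stanleySpace K V (MvPolynomial V K ⧸ J) (Ideal.Quotient.mk J (monomial (w i) 1))
      (A i) = Submodule.span K (b '' T i) := by
    intro i
    rw [stanleySpace]
    congr 1
    ext y
    constructor
    · rintro ⟨u, hu, rfl⟩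
      have hu' : u.support ⊆ A i := by exact_mod_cast hu
      refine ⟨⟨w i + u, ha i u hu'⟩, ⟨u, hu', rfl⟩, ?_⟩
      change Ideal.Quotient.mk J (monomial (w i + u) 1) =
        Ideal.Quotient.mk J (monomial u 1 * monomial (w i) 1)
      rw [monomial_mul, one_mul, add_comm]
    · rintro ⟨m, ⟨u, hu, hm⟩, rfl⟩
      refine ⟨u, by exact_mod_cast hu, ?_⟩
      change Ideal.Quotient.mk J (monomial m.1 1) =
        Ideal.Quotient.mk J (monomial u 1 * monomial (w i) 1)
      rw [monomial_mul, one_mul, add_comm, ← hm]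
  refine ⟨r, fun i => Ideal.Quotient.mk J (monomial (w i) 1), A, ⟨?_, ?_, ?_⟩, hd⟩
  · intro i f hf h0
    change Ideal.Quotient.mk J (f * monomial (w i) 1) = 0 at h0
    rw [Ideal.Quotient.eq_zero_iff_mem, hJ, mem_faceIdeal] at h0
    ext m
    rw [coeff_zero]
    by_contra hm
    have hmA : m.support ⊆ A i := by
      intro v hv
      have : v ∈ f.vars := (mem_vars v).2 ⟨m, mem_support_iff.2 hm, hv⟩
      exact_mod_cast hf this
    have h1 := h0 (m + w i) (by rw [add_comm]; exact ha i m hmA)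
    rw [coeff_mul_monomial, mul_one] at h1
    exact hm h1
  · simp only [hst]
    rw [iSupIndep_def]
    intro i
    have h1 : (⨆ j, ⨆ (_ : j ≠ i), Submodule.span K (b '' T j)) =
        Submodule.span K (b '' ⋃ j, ⋃ (_ : j ≠ i), T j) := by
      simp only [Set.image_iUnion, Submodule.span_iUnion]
    rw [h1]
    apply hbli.disjoint_span_image
    rw [Set.disjoint_left]
    rintro m ⟨u, hu, hm⟩ hm'
    simp only [Set.mem_iUnion] at hm'
    obtain ⟨j, hj, v, hv, hm'⟩ := hm'
    exact hj (hc j i v u hv hu (hm'.symm.trans hm))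
  · simp only [hst]
    rw [← Submodule.span_iUnion, ← Set.image_iUnion, eq_top_iff]
    rintro y -
    obtain ⟨f, rfl⟩ := Ideal.Quotient.mk_surjective y
    rw [f.as_sum, map_sum]
    refine Submodule.sum_mem _ fun m _ => ?_
    have h1 : (monomial m (coeff m f) : MvPolynomial V K) = coeff m f • monomial m 1 := by
      rw [smul_monomial, smul_eq_mul, mul_one]
    rw [h1]
    change coeff m f • (Ideal.Quotient.mk J (monomial m 1)) ∈ _
    apply Submodule.smul_mem
    by_cases hm : Face Adj Finset.univ m
    · apply Submodule.subset_span
      obtain ⟨i, u, hu, hmu⟩ := hb m hm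
      exact ⟨⟨m, hm⟩, Set.mem_iUnion.2 ⟨i, u, hu, hmu⟩, rfl⟩
    · have : Ideal.Quotient.mk J (monomial m (1 : K)) = 0 :=
        Ideal.Quotient.eq_zero_iff_mem.2 (Ideal.subset_span ⟨m, hm, rfl⟩)
      rw [this]
      exact Submodule.zero_mem _

lemma sdepth_eq {K : Type} [Field K] {V : Type} [Fintype V] [DecidableEq V]
    {Adj : V → V → Prop} (hirr : ∀ a, ¬ Adj a a)
    (hsymm : ∀ a b, Adj a b → Adj b a) {F : Finset V} (hF : ∀ a ∈ F, ∀ b ∈ F, ¬ Adj a b)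
    (hmax : ∀ v ∉ F, ∃ a ∈ F, Adj a v) {lab : V → ℕ}
    (hC : Centered Adj lab F.card Finset.univ) :
    sdepth K V (MvPolynomial V K ⧸ edgeIdeal K Adj) = F.card := by
  rw [edgeIdeal_eq_faceIdeal K Adj hirr]
  rw [sdepth]
  apply IsGreatest.csSup_eq
  constructor
  · obtain ⟨r, w, A, hSt, hcard⟩ := exists_stanley (K := K) hirr hsymm hC
    refine ⟨r, w, A, hSt, ?_⟩
    obtain ⟨i, hi⟩ := stanley_exists_eq hF hmax hSt
    symm
    apply IsLeast.csInf_eq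
    refine ⟨⟨i, by simp [hi]⟩, ?_⟩
    rintro _ ⟨j, rfl⟩
    exact hcard j
  · rintro _ ⟨r, w, A, hSt, rfl⟩
    obtain ⟨i, hi⟩ := stanley_exists_eq hF hmax hSt
    exact Nat.sInf_le ⟨i, by simp [hi]⟩

/-! ### The combinatorics of `P*_{n,3}` -/

lemma pStarAdj_inl_inl {n : ℕ} {a b : Fin n × Fin 3} :
    pStarAdj n (Sum.inl a) (Sum.inl b) ↔ pAdj n 3 a b := by
  simp [pStarAdj]

lemma pStarAdj_inl_inr {n : ℕ} {a : Fin n × Fin 3} :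
    pStarAdj n (Sum.inl a) (Sum.inr ()) ↔
      (a.1 : ℕ) = n - 1 ∧ ((a.2 : ℕ) = 1 ∨ (a.2 : ℕ) = 2) := by
  constructor
  · rintro (⟨a', b', -, h, -⟩ | ⟨a', ⟨h, -⟩ | ⟨h, -⟩, h2⟩)
    · cases h
    · cases h
      exact h2
    · cases h
  · intro h
    exact Or.inr ⟨a, Or.inl ⟨rfl, rfl⟩, h⟩

lemma pStarAdj_inr_inr {n : ℕ} : ¬ pStarAdj n (Sum.inr ()) (Sum.inr ()) := by
  simp [pStarAdj]

lemma pStarAdj_symm {n : ℕ} (a b : (Fin n × Fin 3) ⊕ Unit) (h : pStarAdj n a b) :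
    pStarAdj n b a := by
  rcases h with ⟨a', b', h1, h2, h3, h4, h5⟩ | ⟨a', h1, h2⟩
  · refine Or.inl ⟨b', a', h2, h1, h3.symm, ?_, ?_⟩
    · rwa [abs_sub_comm]
    · rwa [abs_sub_comm]
  · exact Or.inr ⟨a', by tauto, h2⟩

lemma pStarAdj_irrefl {n : ℕ} (a : (Fin n × Fin 3) ⊕ Unit) : ¬ pStarAdj n a a := by
  rcases a with a | ⟨⟩
  · rw [pStarAdj_inl_inl]
    exact fun h => h.1 rfl
  · exact pStarAdj_inr_inr

lemma pAdj_col {n : ℕ} {a b : Fin n × Fin 3} (h : pAdj n 3 a b) :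
    (a.1 : ℕ) ≤ b.1 + 1 ∧ (b.1 : ℕ) ≤ a.1 + 1 := by
  have := abs_le.1 h.2.1
  omega

/-- The `k`-th vertex of the small maximal independent set. -/
def starPt (n k : ℕ) : (Fin n × Fin 3) ⊕ Unit :=
  if h : 3 * k + (if n % 3 = 1 then 0 else 1) < n then
    Sum.inl (⟨3 * k + (if n % 3 = 1 then 0 else 1), h⟩, 1) else Sum.inr ()

lemma starPt_inj {n k l : ℕ} (hk : k < (n + 3) / 3) (hl : l < (n + 3) / 3)
    (h : starPt n k = starPt n l) : k = l := by
  by_cases h1 : 3 * k + (if n % 3 = 1 then 0 else 1) < n <;>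
  by_cases h2 : 3 * l + (if n % 3 = 1 then 0 else 1) < n
  · rw [starPt, dif_pos h1, starPt, dif_pos h2] at h
    simp only [Sum.inl.injEq, Prod.mk.injEq, Fin.mk.injEq] at h
    omega
  · rw [starPt, dif_pos h1, starPt, dif_neg h2] at h
    cases h
  · rw [starPt, dif_neg h1, starPt, dif_pos h2] at h
    cases h
  · split_ifs at h1 h2 <;> omega

lemma starPt_indep {n k l : ℕ} (hk : k < (n + 3) / 3) (hl : l < (n + 3) / 3) :
    ¬ pStarAdj n (starPt n k) (starPt n l) := by
  by_cases hkl : k = l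
  · rw [hkl]
    exact pStarAdj_irrefl _
  · have key : ∀ k l : ℕ, k < (n + 3) / 3 → l < (n + 3) / 3 → k ≠ l →
        (h : 3 * k + (if n % 3 = 1 then 0 else 1) < n) →
        ¬ pStarAdj n (Sum.inl (⟨3 * k + (if n % 3 = 1 then 0 else 1), h⟩, 1)) (starPt n l) := by
      intro k l hk hl hkl h hadj
      by_cases h2 : 3 * l + (if n % 3 = 1 then 0 else 1) < n
      · rw [starPt, dif_pos h2, pStarAdj_inl_inl] at hadj
        have := pAdj_col hadj
        simp only at this
        omega
      · rw [starPt, dif_neg h2, pStarAdj_inl_inr] at hadj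
        have := hadj.1
        simp only at this
        split_ifs at this h2 <;> omega
    intro hadj
    by_cases h : 3 * k + (if n % 3 = 1 then 0 else 1) < n
    · refine key k l hk hl hkl h ?_
      rwa [starPt, dif_pos h] at hadj
    · by_cases h' : 3 * l + (if n % 3 = 1 then 0 else 1) < n
      · refine key l k hl hk (Ne.symm hkl) h' ?_
        have hadj := pStarAdj_symm _ _ hadj
        rwa [starPt, dif_pos h'] at hadj
      · rw [starPt, dif_neg h, starPt, dif_neg h'] at hadj
        exact pStarAdj_inr_inr hadj

lemma starPt_dom {n : ℕ} (hn : 2 ≤ n) (v : (Fin n × Fin 3) ⊕ Unit) :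
    ∃ k < (n + 3) / 3, v = starPt n k ∨ pStarAdj n (starPt n k) v := by
  rcases v with ⟨c, r⟩ | ⟨⟩
  · obtain ⟨k, hk, h, h1, h2⟩ : ∃ k < (n + 3) / 3, 3 * k + (if n % 3 = 1 then 0 else 1) < n ∧
        (c : ℕ) ≤ 3 * k + (if n % 3 = 1 then 0 else 1) + 1 ∧
        3 * k + (if n % 3 = 1 then 0 else 1) ≤ (c : ℕ) + 1 := by
      have hc := c.2
      by_cases h : n % 3 = 1
      · exact ⟨((c : ℕ) + 1) / 3, by omega, by rw [if_pos h]; omega, by rw [if_pos h]; omega,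
          by rw [if_pos h]; omega⟩
      · exact ⟨(c : ℕ) / 3, by omega, by rw [if_neg h]; omega, by rw [if_neg h]; omega,
          by rw [if_neg h]; omega⟩
    refine ⟨k, hk, ?_⟩
    by_cases heq : (Sum.inl (c, r) : (Fin n × Fin 3) ⊕ Unit) = starPt n k
    · exact Or.inl heq
    · right
      rw [starPt, dif_pos h] at heq ⊢
      rw [pStarAdj_inl_inl]
      refine ⟨fun h' => heq (by rw [h']), ?_, ?_⟩
      · rw [abs_le]
        simp only
        omega
      · have hr := r.2
        rw [abs_le]
        simp only [Fin.val_one]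
        omega
  · refine ⟨n / 3, by omega, ?_⟩
    by_cases h : 3 * (n / 3) + (if n % 3 = 1 then 0 else 1) < n
    · right
      rw [starPt, dif_pos h, pStarAdj_inl_inr]
      refine ⟨?_, Or.inl rfl⟩
      simp only
      split_ifs at h ⊢ <;> omega
    · left
      rw [starPt, dif_neg h]

/-- The labels showing that `P*_{n,3}` has `⌊n/3⌋ + 1` disjoint closed neighbourhoods. -/
def starLab (n : ℕ) : (Fin n × Fin 3) ⊕ Unit → ℕ
  | Sum.inl a => (n - a.1 + 1) / 3
  | Sum.inr _ => 0

lemma starLab_centered {n : ℕ} (hn : 2 ≤ n) :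
    Centered (pStarAdj n) (starLab n) ((n + 3) / 3) Finset.univ := by
  intro k hk
  by_cases h0 : k = 0
  · subst h0
    refine ⟨Sum.inr (), Finset.mem_univ _, rfl, ?_⟩
    rintro (a | ⟨⟩) - hadj
    · have h := (pStarAdj_inl_inr.1 (pStarAdj_symm _ _ hadj)).1
      simp only [starLab]
      omega
    · rfl
  · refine ⟨Sum.inl (⟨n - 3 * k, by omega⟩, 0), Finset.mem_univ _, ?_, ?_⟩
    · simp only [starLab]
      omega
    · rintro (a | ⟨⟩) - hadj
      · have h := pAdj_col (pStarAdj_inl_inl.1 hadj)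
        have ha := a.1.2
        simp only at h
        simp only [starLab]
        omega
      · have h := (pStarAdj_inl_inr.1 hadj).2
        simp at h

/-- For every integer `n ≥ 2`,
`depth(S*_{n,3}/I(P*_{n,3})) = sdepth(S*_{n,3}/I(P*_{n,3})) = ⌈(n+1)/3⌉`. -/
theorem depth_sdepth_quotient_edgeIdeal_PStar_n_3 (K : Type) [Field K] (n : ℕ) (hn : 2 ≤ n) :
    rdepth K ((Fin n × Fin 3) ⊕ Unit)
        (MvPolynomial ((Fin n × Fin 3) ⊕ Unit) K ⧸ edgeIdeal K (pStarAdj n)) =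
      (n + 3) / 3 ∧
    sdepth K ((Fin n × Fin 3) ⊕ Unit)
        (MvPolynomial ((Fin n × Fin 3) ⊕ Unit) K ⧸ edgeIdeal K (pStarAdj n)) =
      (n + 3) / 3 := by
  classical
  let F : Finset ((Fin n × Fin 3) ⊕ Unit) := (Finset.range ((n + 3) / 3)).image (starPt n)
  have hcard : F.card = (n + 3) / 3 := by
    rw [Finset.card_image_of_injOn, Finset.card_range]
    intro k hk l hl h
    exact starPt_inj (by simpa using hk) (by simpa using hl) h
  have hF : ∀ a ∈ F, ∀ b ∈ F, ¬ pStarAdj n a b := by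
    intro a ha b hb
    obtain ⟨k, hk, rfl⟩ := Finset.mem_image.1 ha
    obtain ⟨l, hl, rfl⟩ := Finset.mem_image.1 hb
    exact starPt_indep (Finset.mem_range.1 hk) (Finset.mem_range.1 hl)
  have hmax : ∀ v ∉ F, ∃ a ∈ F, pStarAdj n a v := by
    intro v hv
    obtain ⟨k, hk, h⟩ := starPt_dom hn v
    have hkF : starPt n k ∈ F := Finset.mem_image.2 ⟨k, Finset.mem_range.2 hk, rfl⟩
    rcases h with rfl | h
    · exact absurd hkF hv
    · exact ⟨_, hkF, h⟩
  have hC : Centered (pStarAdj n) (starLab n) F.card Finset.univ := by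
    rw [hcard]
    exact starLab_centered hn
  exact ⟨(rdepth_eq pStarAdj_irrefl pStarAdj_symm hF hmax hC).trans hcard,
    (sdepth_eq pStarAdj_irrefl pStarAdj_symm hF hmax hC).trans hcard⟩
end

section
/- For every integer n ≥ 2, depth(S**_{n,3}/I(P**_{n,3})) = sdepth(S**_{n,3}/I(P**_{n,3})) = ⌈(n+2)/3⌉. -/
open MvPolynomial

/-- Adjacency in the graph `P**_{n,3}`: the strong product `Pₙ ⊠ P₃` together with two extra
vertices: `z_{n+1}` (encoded `Sum.inr 0`) adjacent exactly to `z_n = (n-1, 2)` and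
`y_n = (n-1, 1)`, and `z_{n+2}` (encoded `Sum.inr 1`) adjacent exactly to `z_1 = (0, 2)`
and `y_1 = (0, 1)` (0-indexed). -/
def pStarStarAdj (n : ℕ) (a b : (Fin n × Fin 3) ⊕ Fin 2) : Prop :=
  (∃ a' b', a = Sum.inl a' ∧ b = Sum.inl b' ∧ pAdj n 3 a' b') ∨
  (∃ a', (a = Sum.inl a' ∧ b = Sum.inr 0 ∨ a = Sum.inr 0 ∧ b = Sum.inl a') ∧
    (a'.1 : ℕ) = n - 1 ∧ ((a'.2 : ℕ) = 1 ∨ (a'.2 : ℕ) = 2)) ∨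
  (∃ a', (a = Sum.inl a' ∧ b = Sum.inr 1 ∨ a = Sum.inr 1 ∧ b = Sum.inl a') ∧
    (a'.1 : ℕ) = 0 ∧ ((a'.2 : ℕ) = 1 ∨ (a'.2 : ℕ) = 2))


namespace PSS

open RingTheory.Sequence

lemma wr_of_exact {R : Type} [CommRing R] (rs : List R) : ∀ {A B C : Type} [AddCommGroup A]
    [AddCommGroup B] [AddCommGroup C] [Module R A] [Module R B] [Module R C]
    (f : A →ₗ[R] B) (g : B →ₗ[R] C), Function.Injective f → Function.Exact f g →
    Function.Surjective g → IsWeaklyRegular A rs → IsWeaklyRegular C rs →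
    IsWeaklyRegular B rs := by
  induction rs with
  | nil => intros; exact IsWeaklyRegular.nil _ _
  | cons r rs ih =>
    intro A B C _ _ _ _ _ _ f g hf hfg hg hA hC
    rw [isWeaklyRegular_cons_iff] at hA hC ⊢
    refine ⟨isSMulRegular_of_range_eq_ker hf hfg.linearMap_ker_eq.symm hA.1 hC.1, ?_⟩
    refine ih (QuotSMulTop.map r f) (QuotSMulTop.map r g) ?_ (QuotSMulTop.map_exact r hfg hg)
      (QuotSMulTop.map_surjective r hg) hA.2 hC.2
    have h0 : Function.Exact (0 : PUnit →ₗ[R] A) f := by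
      intro y
      constructor
      · intro hy
        exact ⟨0, by simpa using (hf (by simpa using hy.symm))⟩
      · rintro ⟨_, rfl⟩; simp
    have h1 := QuotSMulTop.map_first_exact_on_four_term_exact_of_isSMulRegular_last
      (r := r) h0 hfg hC.1
    rw [injective_iff_map_eq_zero]
    intro a ha
    obtain ⟨b, rfl⟩ := (h1 a).1 ha
    obtain ⟨b, rfl⟩ := Submodule.Quotient.mk_surjective _ b
    simp

/-- Depth is bounded by the coheight of any associated prime below the maximal ideal. -/
lemma length_le_coheight {R : Type} [CommRing R] [IsNoetherianRing R] (m : PrimeSpectrum R)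
    (rs : List R) : ∀ (M : Type) [AddCommGroup M] [Module R M] [Module.Finite R M]
    (P : PrimeSpectrum R), P.asIdeal ∈ associatedPrimes R M → P ≤ m →
    (∀ r ∈ rs, r ∈ m.asIdeal) → IsWeaklyRegular M rs →
    (rs.length : ℕ∞) ≤ Order.coheight P := by
  induction rs with
  | nil => intros; simp
  | cons r rs ih =>
    intro M _ _ _ P hP hPm hrs hreg
    rw [isWeaklyRegular_cons_iff] at hreg
    obtain ⟨hr, hreg⟩ := hreg
    obtain ⟨-, x, hx⟩ := (isAssociatedPrime_iff).1 hP
    have hx' : ∀ p, p ∈ P.asIdeal ↔ p • x = 0 := by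
      intro p; rw [hx, Submodule.mem_colon_singleton, Submodule.mem_bot]
    have hx0 : x ≠ 0 := by
      rintro rfl
      exact P.isPrime.ne_top (Ideal.eq_top_iff_one _ |>.2 ((hx' 1).2 (by simp)))
    let L : Submodule R M := Submodule.torsionBySet R M (P.asIdeal : Set R)
    have hL : ∀ y, y ∈ L ↔ ∀ p ∈ P.asIdeal, p • y = 0 := by
      intro y
      simp [L, Submodule.mem_torsionBySet_iff]
    have hxL : x ∈ L := (hL x).2 fun p hp => (hx' p).1 hp
    -- r not in P
    have hrP : r ∉ P.asIdeal := by
      intro h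
      exact hx0 (hr.right_eq_zero_of_smul ((hx' r).1 h))
    -- m in support
    have hsupp : m ∈ Module.support R L := by
      rw [Module.mem_support_iff_of_finite]
      refine le_trans ?_ hPm
      intro p hp
      rw [Module.mem_annihilator] at hp
      have := congrArg Subtype.val (hp ⟨x, hxL⟩)
      exact (hx' p).2 this
    have hsupp2 : m ∈ Module.support R (QuotSMulTop r L) := by
      rw [Module.support_quotSMulTop]
      refine ⟨hsupp, ?_⟩
      simpa using hrs r (by simp)
    rw [Module.mem_support_iff_of_finite] at hsupp2
    obtain ⟨Q, hQmin, hQm⟩ := Ideal.exists_minimalPrimes_le hsupp2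
    have hQass := Module.associatedPrimes.minimalPrimes_annihilator_subset_associatedPrimes R
      (QuotSMulTop r L) hQmin
    have hinj : Function.Injective (QuotSMulTop.map r L.subtype) := by
      rw [injective_iff_map_eq_zero]
      intro a ha
      obtain ⟨b, rfl⟩ := Submodule.Quotient.mk_surjective _ a
      rw [QuotSMulTop.map_apply_mk, Submodule.Quotient.mk_eq_zero,
        Submodule.mem_smul_pointwise_iff_exists] at ha
      obtain ⟨c, -, hc⟩ := ha
      rw [Submodule.Quotient.mk_eq_zero, Submodule.mem_smul_pointwise_iff_exists]
      have hcL : c ∈ L := by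
        rw [hL]
        intro p hp
        apply hr.right_eq_zero_of_smul
        rw [smul_comm, hc]
        exact (hL _).1 b.2 p hp
      exact ⟨⟨c, hcL⟩, trivial, Subtype.ext hc⟩
    have hQass' := associatedPrimes.subset_of_injective hinj hQass
    have hQp : Q.IsPrime := hQass'.1
    have hann : Module.annihilator R (QuotSMulTop r L) ≤ Q := hQmin.1.2
    have hPQ : P.asIdeal ≤ Q := by
      refine le_trans ?_ hann
      intro p hp
      rw [Module.mem_annihilator]
      intro y
      obtain ⟨b, rfl⟩ := Submodule.Quotient.mk_surjective _ y
      rw [← Submodule.Quotient.mk_smul]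
      have : p • b = 0 := Subtype.ext ((hL _).1 b.2 p hp)
      rw [this]; simp
    have hrQ : r ∈ Q := hann (QuotSMulTop.mem_annihilator _ r)
    let Q' : PrimeSpectrum R := ⟨Q, hQp⟩
    have hlt : P < Q' := by
      refine lt_of_le_of_ne hPQ ?_
      rintro h
      rw [h] at hrP
      exact hrP hrQ
    have := ih (QuotSMulTop r M) Q' hQass' hQm (fun s hs => hrs s (by simp [hs])) hreg
    calc ((r :: rs).length : ℕ∞) = rs.length + 1 := by simp
      _ ≤ Order.coheight Q' + 1 := by gcongr
      _ ≤ Order.coheight P := Order.coheight_add_one_le hlt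

end PSS

namespace PSS

open RingTheory.Sequence

section Upper

variable {K : Type} [Field K] {V : Type} [Fintype V] [DecidableEq V]

/-- Restriction of polynomials to the variables in `U`. -/
noncomputable def rho (K : Type) [Field K] (U : Finset V) :
    MvPolynomial V K →ₐ[K] MvPolynomial U K :=
  aeval (fun v => if h : v ∈ U then X ⟨v, h⟩ else 0)

lemma rho_X_mem (U : Finset V) {v : V} (h : v ∈ U) : rho K U (X v) = X ⟨v, h⟩ := by
  simp [rho, h]

lemma rho_X_not_mem (U : Finset V) {v : V} (h : v ∉ U) : rho K U (X v) = 0 := by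
  simp [rho, h]

lemma rho_surj (U : Finset V) : Function.Surjective (rho K U) := by
  intro p
  refine ⟨rename Subtype.val p, ?_⟩
  rw [rho, aeval_rename]
  conv_rhs => rw [← aeval_X_left_apply p]
  congr 2
  ext v
  simp

variable {Adj : V → V → Prop} {U : Finset V}

lemma edgeIdeal_le_ker (hind : ∀ a ∈ U, ∀ b ∈ U, ¬ Adj a b) :
    edgeIdeal K Adj ≤ RingHom.ker (rho K U) := by
  rw [edgeIdeal, Ideal.span_le]
  rintro p ⟨a, b, hab, rfl⟩
  simp only [SetLike.mem_coe, RingHom.mem_ker, map_mul]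
  by_cases ha : a ∈ U
  · by_cases hb : b ∈ U
    · exact absurd hab (hind a ha b hb)
    · rw [rho_X_not_mem U hb, mul_zero]
  · rw [rho_X_not_mem U ha, zero_mul]

lemma mul_prod_mem (hdom : ∀ a, a ∉ U → ∃ u ∈ U, Adj a u) {a : V} (ha : a ∉ U) :
    X a * ∏ u ∈ U, X u ∈ edgeIdeal K Adj := by
  obtain ⟨u, hu, hau⟩ := hdom a ha
  rw [← Finset.mul_prod_erase U _ hu, ← mul_assoc]
  exact Ideal.mul_mem_right _ _ (Ideal.subset_span ⟨a, u, hau, rfl⟩)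

lemma mem_ker_iff (hind : ∀ a ∈ U, ∀ b ∈ U, ¬ Adj a b)
    (hdom : ∀ a, a ∉ U → ∃ u ∈ U, Adj a u) (p : MvPolynomial V K) :
    p * ∏ u ∈ U, X u ∈ edgeIdeal K Adj ↔ p ∈ RingHom.ker (rho K U) := by
  constructor
  · intro h
    have h1 := edgeIdeal_le_ker hind h
    rw [RingHom.mem_ker, map_mul] at h1
    rw [RingHom.mem_ker]
    refine (mul_eq_zero.1 h1).resolve_right ?_
    rw [map_prod, ← ne_eq, Finset.prod_ne_zero_iff]
    intro a ha
    rw [rho_X_mem U ha]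
    exact X_ne_zero _
  · have key : ∀ p : MvPolynomial V K,
        (p - rename Subtype.val (rho K U p)) * ∏ u ∈ U, X u ∈ edgeIdeal K Adj := by
      intro p
      induction p using MvPolynomial.induction_on with
      | C a =>
        have : rho K U (C a) = C a := by rw [rho, aeval_C]; rfl
        rw [this, rename_C, sub_self, zero_mul]
        exact Ideal.zero_mem _
      | add p q hp hq =>
        have := Ideal.add_mem _ hp hq
        convert this using 1
        rw [map_add, map_add]; ring
      | mul_X p v hp =>
        by_cases hv : v ∈ U
        · rw [map_mul, map_mul, rho_X_mem U hv, rename_X, ← sub_mul, mul_assoc, mul_comm (X v),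
            ← mul_assoc]
          exact Ideal.mul_mem_right _ _ hp
        · rw [map_mul, rho_X_not_mem U hv, mul_zero, map_zero, sub_zero, mul_assoc]
          exact Ideal.mul_mem_left _ _ (mul_prod_mem hdom hv)
    intro hp
    have := key p
    rw [RingHom.mem_ker] at hp
    rwa [hp, map_zero, sub_zero] at this

lemma length_le_card (hind : ∀ a ∈ U, ∀ b ∈ U, ¬ Adj a b)
    (hdom : ∀ a, a ∉ U → ∃ u ∈ U, Adj a u) (rs : List (MvPolynomial V K))
    (hrs : ∀ f ∈ rs, f ∈ Ideal.span (Set.range (X : V → MvPolynomial V K)))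
    (hreg : IsRegular (MvPolynomial V K ⧸ edgeIdeal K Adj) rs) : rs.length ≤ U.card := by
  let P : PrimeSpectrum (MvPolynomial V K) := ⟨RingHom.ker (rho K U), RingHom.ker_isPrime _⟩
  let m : PrimeSpectrum (MvPolynomial V K) :=
    ⟨RingHom.ker (constantCoeff : MvPolynomial V K →+* K), RingHom.ker_isPrime _⟩
  have hP : P.asIdeal ∈ associatedPrimes (MvPolynomial V K)
      (MvPolynomial V K ⧸ edgeIdeal K Adj) := by
    refine isAssociatedPrime_iff.2 ⟨P.isPrime, Ideal.Quotient.mk _ (∏ u ∈ U, X u), ?_⟩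
    ext p
    rw [Submodule.mem_colon_singleton, Submodule.mem_bot]
    rw [show p • (Ideal.Quotient.mk (edgeIdeal K Adj)) (∏ u ∈ U, X u) =
      Ideal.Quotient.mk (edgeIdeal K Adj) (p * ∏ u ∈ U, X u) from rfl,
      Ideal.Quotient.eq_zero_iff_mem, mem_ker_iff hind hdom]
  have hPm : P ≤ m := by
    intro p hp
    have hp' : rho K U p = 0 := hp
    change constantCoeff p = 0
    have : (constantCoeff : MvPolynomial U K →+* K).comp (rho K U).toRingHom =
        (constantCoeff : MvPolynomial V K →+* K) := by
      apply MvPolynomial.ringHom_ext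
      · intro r; simp
      · intro i
        by_cases hi : i ∈ U
        · simp [rho_X_mem U hi]
        · simp [rho_X_not_mem U hi]
    rw [← this]
    simp [hp']
  have h := length_le_coheight m rs _ P hP hPm ?_ hreg.toIsWeaklyRegular
  · have h2 : ((Order.coheight P : ℕ∞) : WithBot ℕ∞) = U.card := by
      rw [Order.coheight_eq_krullDim_Ici]
      have h3 : Order.krullDim (Set.Ici P) =
          Order.krullDim (PrimeSpectrum.zeroLocus (P.asIdeal : Set (MvPolynomial V K))) := rfl
      have h5 : ringKrullDim (MvPolynomial V K ⧸ P.asIdeal) = ringKrullDim (MvPolynomial U K) :=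
        ringKrullDim_eq_of_ringEquiv
          (RingHom.quotientKerEquivOfSurjective (f := (rho K U).toRingHom) (rho_surj U))
      rw [h3, ← ringKrullDim_quotient, h5, MvPolynomial.ringKrullDim_of_isNoetherianRing, ringKrullDim_eq_zero_of_field]
      simp
    have h4 : Order.coheight P = (U.card : ℕ∞) := by exact_mod_cast h2
    rw [h4] at h
    exact_mod_cast h
  · intro r hr
    have : Ideal.span (Set.range (X : V → MvPolynomial V K)) ≤ m.asIdeal := by
      rw [Ideal.span_le]
      rintro _ ⟨v, rfl⟩
      simp [m]
    exact this (hrs r hr)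

lemma stanley_upper (hind : ∀ a ∈ U, ∀ b ∈ U, ¬ Adj a b)
    (hdom : ∀ a, a ∉ U → ∃ u ∈ U, Adj a u) {r : ℕ}
    (w : Fin r → MvPolynomial V K ⧸ edgeIdeal K Adj) (A : Fin r → Finset V)
    (h : IsStanleyDecomp K V _ w A) : sInf (Set.range fun i => (A i).card) ≤ U.card := by
  by_contra hlt
  push Not at hlt
  have hA : ∀ i, U.card < (A i).card := fun i => lt_of_lt_of_le hlt (Nat.sInf_le ⟨i, rfl⟩)
  obtain ⟨hfree, -, htop⟩ := h
  have hUA : ∀ i, ∃ a ∈ U, a ∉ A i := by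
    intro i
    by_contra hcon
    push Not at hcon
    obtain ⟨a, haA, haU⟩ := Finset.exists_mem_notMem_of_card_lt_card (hA i)
    obtain ⟨u, hu, hau⟩ := hdom a haU
    have := hfree i (X a * X u) ?_ ?_
    · exact mul_ne_zero (X_ne_zero a) (X_ne_zero u) this
    · intro v hv
      have := vars_mul _ _ hv
      simp only [vars_X, Finset.mem_union, Finset.mem_singleton] at this
      rcases this with rfl | rfl
      · exact haA
      · exact hcon _ hu
    · obtain ⟨p, hp⟩ := Ideal.Quotient.mk_surjective (w i)
      rw [← hp]
      rw [show (X a * X u) • (Ideal.Quotient.mk (edgeIdeal K Adj)) p =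
        Ideal.Quotient.mk (edgeIdeal K Adj) ((X a * X u) * p) from rfl,
        Ideal.Quotient.eq_zero_iff_mem]
      exact Ideal.mul_mem_right _ _ (Ideal.subset_span ⟨a, u, hau, rfl⟩)
  let pb : (MvPolynomial V K ⧸ edgeIdeal K Adj) →ₐ[K] MvPolynomial U K :=
    Ideal.Quotient.liftₐ _ (rho K U) (fun a ha => edgeIdeal_le_ker hind ha)
  have hpb : ∀ p, pb (Ideal.Quotient.mk _ p) = rho K U p := fun p => rfl
  let D : ℕ := 1 + ∑ i, (pb (w i)).totalDegree
  let E : U →₀ ℕ := Finsupp.equivFunOnFinite.symm (fun _ => D)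
  let φ : (MvPolynomial V K ⧸ edgeIdeal K Adj) →ₗ[K] K := (lcoeff K E).comp pb.toLinearMap
  have hker : (⊤ : Submodule K (MvPolynomial V K ⧸ edgeIdeal K Adj)) ≤ LinearMap.ker φ := by
    rw [← htop, iSup_le_iff]
    intro i
    rw [stanleySpace, Submodule.span_le]
    rintro _ ⟨u, hu, rfl⟩
    obtain ⟨a, haU, haA⟩ := hUA i
    have h1 : pb ((monomial u (1 : K) : MvPolynomial V K) • w i) =
        rho K U (monomial u 1) * pb (w i) := by
      obtain ⟨p, hp⟩ := Ideal.Quotient.mk_surjective (w i)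
      rw [← hp, hpb, ← map_mul]
      rfl
    change coeff E (pb ((monomial u (1 : K) : MvPolynomial V K) • w i)) = 0
    rw [h1]
    by_contra hne
    have h2 : E ⟨a, haU⟩ ≤ degreeOf ⟨a, haU⟩ (rho K U (monomial u 1) * pb (w i)) :=
      monomial_le_degreeOf _ (mem_support_iff.2 hne)
    have h3 : degreeOf ⟨a, haU⟩ (rho K U (monomial u 1)) = 0 := by
      rw [monomial_eq, C_1, one_mul, Finsupp.prod, map_prod]
      refine Nat.le_zero.1 ((degreeOf_prod_le _ _ _).trans ?_)
      refine (Finset.sum_eq_zero ?_).le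
      intro v hv
      have hva : v ≠ a := by
        rintro rfl
        exact haA (hu hv)
      rw [map_pow]
      refine Nat.le_zero.1 ((degreeOf_pow_le _ _ _).trans ?_)
      by_cases hvU : v ∈ U
      · rw [rho_X_mem U hvU, degreeOf_X_of_ne]
        · simp
        · intro h
          exact hva (congrArg Subtype.val h).symm
      · rw [rho_X_not_mem U hvU]; simp
    have h4 := degreeOf_mul_le ⟨a, haU⟩ (rho K U (monomial u 1)) (pb (w i))
    have h5 := degreeOf_le_totalDegree (pb (w i)) ⟨a, haU⟩
    have h6 : (pb (w i)).totalDegree ≤ ∑ i, (pb (w i)).totalDegree :=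
      Finset.single_le_sum (f := fun i => (pb (w i)).totalDegree) (fun _ _ => Nat.zero_le _)
        (Finset.mem_univ i)
    have h7 : E ⟨a, haU⟩ = 1 + ∑ i, (pb (w i)).totalDegree := rfl
    omega
  obtain ⟨p, hp⟩ := rho_surj (K := K) U (monomial E 1)
  have h8 : φ (Ideal.Quotient.mk _ p) = 0 := hker trivial
  have h9 : φ (Ideal.Quotient.mk _ p) = coeff E (rho K U p) := rfl
  rw [h9, hp, coeff_monomial, if_pos rfl] at h8
  exact one_ne_zero h8

end Upper

end PSS

namespace PSS

open RingTheory.Sequence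
open scoped Pointwise

section Lower

variable {K : Type} [Field K] {V : Type} [Fintype V] [DecidableEq V]

/-- The edge ideal together with a set of killed variables. -/
noncomputable def IZ (K : Type) [Field K] {V : Type} (Adj : V → V → Prop) (Z : Finset V) :
    Ideal (MvPolynomial V K) :=
  edgeIdeal K Adj ⊔ Ideal.span (X '' (Z : Set V))

/-- Exponents of monomials in `IZ`. -/
def Bad (Adj : V → V → Prop) (Z : Finset V) (m : V →₀ ℕ) : Prop :=
  (∃ z ∈ Z, m z ≠ 0) ∨ ∃ a b, Adj a b ∧ m a ≠ 0 ∧ m b ≠ 0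

variable {Adj : V → V → Prop}

lemma mem_IZ (hirr : ∀ a, ¬ Adj a a) (Z : Finset V) (p : MvPolynomial V K) :
    p ∈ IZ K Adj Z ↔ ∀ m ∈ p.support, Bad Adj Z m := by
  let s : Set (V →₀ ℕ) := {e | ∃ a b, Adj a b ∧ e = Finsupp.single a 1 + Finsupp.single b 1} ∪
    {e | ∃ z ∈ Z, e = Finsupp.single z 1}
  have h1 : IZ K Adj Z = Ideal.span ((fun s => monomial s (1 : K)) '' s) := by
    rw [IZ, edgeIdeal, ← Ideal.span_union, Set.image_union]
    congr 2
    · ext q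
      constructor
      · rintro ⟨a, b, hab, rfl⟩
        exact ⟨_, ⟨a, b, hab, rfl⟩, by simp [X, monomial_mul]⟩
      · rintro ⟨_, ⟨a, b, hab, rfl⟩, rfl⟩
        exact ⟨a, b, hab, by simp [X, monomial_mul]⟩
    · ext q
      constructor
      · rintro ⟨z, hz, rfl⟩
        exact ⟨_, ⟨z, hz, rfl⟩, rfl⟩
      · rintro ⟨_, ⟨z, hz, rfl⟩, rfl⟩
        exact ⟨z, hz, rfl⟩
  rw [h1, mem_ideal_span_monomial_image]
  refine forall₂_congr fun m _ => ?_
  constructor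
  · rintro ⟨e, ⟨a, b, hab, rfl⟩ | ⟨z, hz, rfl⟩, he⟩
    · right
      refine ⟨a, b, hab, ?_, ?_⟩
      · have := he a
        simp at this
        omega
      · have := he b
        simp at this
        omega
    · left
      refine ⟨z, hz, ?_⟩
      have := he z
      simp at this
      omega
  · rintro (⟨z, hz, hm⟩ | ⟨a, b, hab, ha, hb⟩)
    · refine ⟨_, Or.inr ⟨z, hz, rfl⟩, ?_⟩
      intro x
      by_cases hx : x = z
      · subst hx; simp; omega
      · simp [Finsupp.single_apply, Ne.symm hx]
    · refine ⟨_, Or.inl ⟨a, b, hab, rfl⟩, ?_⟩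
      have hne : a ≠ b := by rintro rfl; exact hirr _ hab
      intro x
      by_cases hxa : x = a
      · subst hxa; simp [hne.symm]; omega
      · by_cases hxb : x = b
        · subst hxb; simp [hne]; omega
        · simp [Ne.symm hxa, Ne.symm hxb]

open Classical in
/-- Neighbours. -/
noncomputable def nb (Adj : V → V → Prop) (w : V) : Finset V := Finset.univ.filter (Adj w)

lemma mem_nb {w x : V} : x ∈ nb Adj w ↔ Adj w x := by simp [nb]

lemma colon_IZ (hirr : ∀ a, ¬ Adj a a) (hsymm : ∀ a b, Adj a b → Adj b a) (Z : Finset V) {w : V}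
    (hw : w ∉ Z) (p : MvPolynomial V K) :
    p * X w ∈ IZ K Adj Z ↔ p ∈ IZ K Adj (Z ∪ nb Adj w) := by
  rw [mem_IZ hirr, mem_IZ hirr, support_mul_X]
  simp only [Finset.mem_map, forall_exists_index, and_imp, forall_apply_eq_imp_iff₂,
    addRightEmbedding_apply]
  refine forall₂_congr fun m _ => ?_
  have key : ∀ x, (m + Finsupp.single w 1 : V →₀ ℕ) x ≠ 0 ↔ x = w ∨ m x ≠ 0 := by
    intro x
    by_cases hx : x = w
    · subst hx; simp
    · simp [hx, Ne.symm hx]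
  simp only [Bad, key, Finset.mem_union, mem_nb]
  constructor
  · rintro (⟨z, hz, rfl | hm⟩ | ⟨a, b, hab, rfl | ha, rfl | hb⟩)
    · exact absurd hz hw
    · exact Or.inl ⟨z, Or.inl hz, hm⟩
    · exact absurd hab (hirr _)
    · exact Or.inl ⟨b, Or.inr hab, hb⟩
    · exact Or.inl ⟨a, Or.inr (hsymm _ _ hab), ha⟩
    · exact Or.inr ⟨a, b, hab, ha, hb⟩
  · rintro (⟨z, hz | hz, hm⟩ | ⟨a, b, hab, ha, hb⟩)
    · exact Or.inl ⟨z, hz, Or.inr hm⟩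
    · exact Or.inr ⟨w, z, hz, Or.inl rfl, Or.inr hm⟩
    · exact Or.inr ⟨a, b, hab, Or.inr ha, Or.inr hb⟩

lemma IZ_insert (Z : Finset V) (w : V) :
    IZ K Adj (insert w Z) = IZ K Adj Z ⊔ Ideal.span {X w} := by
  rw [IZ, IZ, sup_assoc, ← Ideal.span_union]
  congr 2
  rw [Finset.coe_insert, Set.image_insert_eq, Set.union_singleton]

lemma IZ_le_insert (Z : Finset V) (w : V) : IZ K Adj Z ≤ IZ K Adj (insert w Z) := by
  rw [IZ_insert]; exact le_sup_left

lemma mem_insert_iff (Z : Finset V) (w : V) (p : MvPolynomial V K) :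
    p ∈ IZ K Adj (insert w Z) ↔ ∃ q, p - q * X w ∈ IZ K Adj Z := by
  rw [IZ_insert, Submodule.mem_sup]
  constructor
  · rintro ⟨y, hy, z, hz, rfl⟩
    obtain ⟨q, rfl⟩ := Ideal.mem_span_singleton'.1 hz
    exact ⟨q, by simpa using hy⟩
  · rintro ⟨q, hq⟩
    exact ⟨_, hq, q * X w, Ideal.mem_span_singleton'.2 ⟨q, rfl⟩, by ring⟩

lemma split_wr (hirr : ∀ a, ¬ Adj a a) (hsymm : ∀ a b, Adj a b → Adj b a) (Z : Finset V) {w : V}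
    (hw : w ∉ Z) (rs : List (MvPolynomial V K))
    (h1 : IsWeaklyRegular (MvPolynomial V K ⧸ IZ K Adj (Z ∪ nb Adj w)) rs)
    (h2 : IsWeaklyRegular (MvPolynomial V K ⧸ IZ K Adj (insert w Z)) rs) :
    IsWeaklyRegular (MvPolynomial V K ⧸ IZ K Adj Z) rs := by
  let f : (MvPolynomial V K ⧸ IZ K Adj (Z ∪ nb Adj w)) →ₗ[MvPolynomial V K]
      (MvPolynomial V K ⧸ IZ K Adj Z) :=
    Submodule.mapQ _ _ (LinearMap.mulRight (MvPolynomial V K) (X w))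
      (fun p hp => (colon_IZ hirr hsymm Z hw p).2 hp)
  let g : (MvPolynomial V K ⧸ IZ K Adj Z) →ₗ[MvPolynomial V K]
      (MvPolynomial V K ⧸ IZ K Adj (insert w Z)) :=
    Submodule.mapQ _ _ LinearMap.id (IZ_le_insert Z w)
  have hf : ∀ p, f (Submodule.Quotient.mk p) = Submodule.Quotient.mk (p * X w) := fun p => rfl
  have hg : ∀ p, g (Submodule.Quotient.mk p) = Submodule.Quotient.mk p := fun p => rfl
  refine wr_of_exact rs f g ?_ ?_ ?_ h1 h2
  · rw [injective_iff_map_eq_zero]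
    intro a ha
    obtain ⟨p, rfl⟩ := Submodule.Quotient.mk_surjective _ a
    rw [hf, Submodule.Quotient.mk_eq_zero, colon_IZ hirr hsymm Z hw] at ha
    rwa [Submodule.Quotient.mk_eq_zero]
  · intro a
    obtain ⟨p, rfl⟩ := Submodule.Quotient.mk_surjective _ a
    rw [hg, Submodule.Quotient.mk_eq_zero, mem_insert_iff]
    constructor
    · rintro ⟨q, hq⟩
      refine ⟨Submodule.Quotient.mk q, ?_⟩
      rw [hf, eq_comm, Submodule.Quotient.eq]
      exact hq
    · rintro ⟨b, hb⟩
      obtain ⟨q, rfl⟩ := Submodule.Quotient.mk_surjective _ b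
      rw [hf, eq_comm, Submodule.Quotient.eq] at hb
      exact ⟨q, hb⟩
  · intro a
    obtain ⟨p, rfl⟩ := Submodule.Quotient.mk_surjective _ a
    exact ⟨Submodule.Quotient.mk p, rfl⟩

lemma wr_X (hirr : ∀ a, ¬ Adj a a) (hsymm : ∀ a b, Adj a b → Adj b a) (us : List V) :
    ∀ (Z : Finset V), us.Nodup → (∀ u ∈ us, u ∉ Z) → (∀ u ∈ us, nb Adj u ⊆ Z) →
    IsWeaklyRegular (MvPolynomial V K ⧸ IZ K Adj Z)
      (us.map (X : V → MvPolynomial V K)) := by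
  induction us with
  | nil => intros; exact IsWeaklyRegular.nil _ _
  | cons u us ih =>
    intro Z hnd hZ hnb
    rw [List.map_cons, isWeaklyRegular_cons_iff]
    have huZ := hZ u (by simp)
    have hun : Z ∪ nb Adj u = Z := Finset.union_eq_left.2 (hnb u (by simp))
    constructor
    · refine IsSMulRegular.of_right_eq_zero_of_smul ?_
      intro a ha
      obtain ⟨p, rfl⟩ := Submodule.Quotient.mk_surjective _ a
      rw [← Submodule.Quotient.mk_smul, Submodule.Quotient.mk_eq_zero, smul_eq_mul, mul_comm,
        colon_IZ hirr hsymm Z huZ, hun] at ha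
      rwa [Submodule.Quotient.mk_eq_zero]
    · let g : (MvPolynomial V K ⧸ IZ K Adj Z) →ₗ[MvPolynomial V K]
          (MvPolynomial V K ⧸ IZ K Adj (insert u Z)) :=
        Submodule.mapQ _ _ LinearMap.id (IZ_le_insert Z u)
      have hg : ∀ p, g (Submodule.Quotient.mk p) = Submodule.Quotient.mk p := fun p => rfl
      have hgs : Function.Surjective g := by
        intro a
        obtain ⟨p, rfl⟩ := Submodule.Quotient.mk_surjective _ a
        exact ⟨Submodule.Quotient.mk p, rfl⟩
      have hker : (X u : MvPolynomial V K) •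
          (⊤ : Submodule (MvPolynomial V K) (MvPolynomial V K ⧸ IZ K Adj Z)) =
          LinearMap.ker g := by
        ext a
        obtain ⟨p, rfl⟩ := Submodule.Quotient.mk_surjective _ a
        rw [LinearMap.mem_ker, hg, Submodule.Quotient.mk_eq_zero, mem_insert_iff,
          Submodule.mem_smul_pointwise_iff_exists]
        constructor
        · rintro ⟨b, -, hb⟩
          obtain ⟨q, rfl⟩ := Submodule.Quotient.mk_surjective _ b
          rw [← Submodule.Quotient.mk_smul, eq_comm, Submodule.Quotient.eq, smul_eq_mul,
            mul_comm] at hb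
          exact ⟨q, hb⟩
        · rintro ⟨q, hq⟩
          refine ⟨Submodule.Quotient.mk q, trivial, ?_⟩
          rw [← Submodule.Quotient.mk_smul, eq_comm, Submodule.Quotient.eq, smul_eq_mul,
            mul_comm]
          exact hq
      let e : QuotSMulTop (X u : MvPolynomial V K) (MvPolynomial V K ⧸ IZ K Adj Z)
          ≃ₗ[MvPolynomial V K] (MvPolynomial V K ⧸ IZ K Adj (insert u Z)) :=
        (Submodule.quotEquivOfEq _ _ hker).trans (g.quotKerEquivOfSurjective hgs)
      rw [e.isWeaklyRegular_congr]
      rw [List.nodup_cons] at hnd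
      refine ih (insert u Z) hnd.2 ?_ ?_
      · intro x hx
        rw [Finset.mem_insert, not_or]
        refine ⟨?_, hZ x (by simp [hx])⟩
        rintro rfl
        exact hnd.1 hx
      · intro x hx
        exact (hnb x (by simp [hx])).trans (Finset.subset_insert _ _)

/-- Change of variables. -/
noncomputable def theta {k : ℕ} (u : Fin k → V) (g : Fin k → MvPolynomial V K) (c : K) :
    MvPolynomial V K →ₐ[K] MvPolynomial V K :=
  aeval (fun x => X x + ∑ i, if u i = x then C c * g i else 0)

lemma theta_u {k : ℕ} (u : Fin k → V) (hu : Function.Injective u)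
    (g : Fin k → MvPolynomial V K) (c : K) (j : Fin k) :
    theta u g c (X (u j)) = X (u j) + C c * g j := by
  rw [theta, aeval_X, Finset.sum_eq_single j]
  · simp
  · intro i _ hij
    rw [if_neg (fun h => hij (hu h))]
  · simp

lemma theta_not {k : ℕ} (u : Fin k → V)
    (g : Fin k → MvPolynomial V K) (c : K) (x : V) (hx : ∀ i, u i ≠ x) :
    theta u g c (X x) = X x := by
  rw [theta, aeval_X, Finset.sum_eq_zero, add_zero]
  intro i _
  rw [if_neg (hx i)]

lemma theta_IZ (hsymm : ∀ a b, Adj a b → Adj b a) {k : ℕ} (u : Fin k → V)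
    (g : Fin k → MvPolynomial V K) (c : K)
    (Z : Finset V) (hZ : ∀ i, u i ∉ Z) (hnb : ∀ i, nb Adj (u i) ⊆ Z) :
    IZ K Adj Z ≤ (IZ K Adj Z).comap (theta u g c) := by
  have hz : ∀ z ∈ Z, X z ∈ IZ K Adj Z := fun z hz =>
    (le_sup_right : _ ≤ IZ K Adj Z) (Ideal.subset_span ⟨z, hz, rfl⟩)
  have hzt : ∀ z ∈ Z, theta u g c (X z) ∈ IZ K Adj Z := by
    intro z h
    rw [theta_not]
    · exact hz z h
    · rintro i rfl
      exact hZ i h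
  conv_lhs => rw [IZ]
  rw [sup_le_iff]
  constructor
  · rw [edgeIdeal, Ideal.span_le]
    rintro _ ⟨a, b, hab, rfl⟩
    change theta u g c (X a * X b) ∈ IZ K Adj Z
    rw [map_mul]
    by_cases ha : ∃ i, u i = a
    · obtain ⟨i, rfl⟩ := ha
      exact Ideal.mul_mem_left _ _ (hzt b (hnb i (mem_nb.2 hab)))
    · by_cases hb : ∃ i, u i = b
      · obtain ⟨i, rfl⟩ := hb
        exact Ideal.mul_mem_right _ _ (hzt a (hnb i (mem_nb.2 (hsymm _ _ hab))))
      · push Not at ha hb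
        rw [theta_not u g c a ha, theta_not u g c b hb]
        exact (le_sup_left : _ ≤ IZ K Adj Z) (Ideal.subset_span ⟨a, b, hab, rfl⟩)
  · rw [Ideal.span_le]
    rintro _ ⟨z, h, rfl⟩
    exact hzt z h

lemma theta_comp {k : ℕ} (u : Fin k → V) (hu : Function.Injective u)
    (g : Fin k → MvPolynomial V K) (hg : ∀ c j, theta u g c (g j) = g j) (c d : K)
    (hcd : c + d = 0) : (theta u g c).comp (theta u g d) = AlgHom.id K _ := by
  apply MvPolynomial.algHom_ext
  intro x
  rw [AlgHom.comp_apply, AlgHom.id_apply]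
  by_cases hx : ∃ i, u i = x
  · obtain ⟨i, rfl⟩ := hx
    have hC : theta u g c (C d) = C d := by
      rw [theta, aeval_C]; rfl
    rw [theta_u u hu, map_add, theta_u u hu, map_mul, hg, hC, add_assoc, ← add_mul, ← C_add, hcd]
    simp
  · push Not at hx
    rw [theta_not u g d x hx, theta_not u g c x hx]

lemma wr_terminal (hirr : ∀ a, ¬ Adj a a) (hsymm : ∀ a b, Adj a b → Adj b a) {k : ℕ}
    (N : Fin k → Finset V) (hN : ∀ i j, i ≠ j → Disjoint (N i) (N j)) (Z : Finset V)
    (u : Fin k → V) (huN : ∀ i, u i ∈ N i) (hZ : ∀ i, u i ∉ Z) (hnb : ∀ i, nb Adj (u i) ⊆ Z) :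
    IsWeaklyRegular (MvPolynomial V K ⧸ IZ K Adj Z)
      (List.ofFn fun i => ∑ x ∈ N i, (X x : MvPolynomial V K)) := by
  have hu : Function.Injective u := by
    intro i j hij
    by_contra hne
    exact Finset.disjoint_left.1 (hN i j hne) (huN i) (hij ▸ huN j)
  let g : Fin k → MvPolynomial V K := fun i => ∑ x ∈ (N i).erase (u i), X x
  have hg : ∀ c j, theta u g c (g j) = g j := by
    intro c j
    simp only [g, map_sum]
    refine Finset.sum_congr rfl fun x hx => ?_
    rw [Finset.mem_erase] at hx
    apply theta_not
    rintro i rfl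
    by_cases hij : i = j
    · exact hx.1 (by rw [hij])
    · exact Finset.disjoint_left.1 (hN i j hij) (huN i) hx.2
  let φ : MvPolynomial V K ≃ₐ[K] MvPolynomial V K :=
    AlgEquiv.ofAlgHom (theta u g 1) (theta u g (-1))
      (theta_comp u hu g hg 1 (-1) (by simp)) (theta_comp u hu g hg (-1) 1 (by simp))
  have hmap : IZ K Adj Z = (IZ K Adj Z).map (φ.toRingEquiv : MvPolynomial V K →+* MvPolynomial V K) := by
    apply le_antisymm
    · intro p hp
      have h1 : theta u g (-1) p ∈ IZ K Adj Z := theta_IZ hsymm u g (-1) Z hZ hnb hp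
      have h2 := Ideal.mem_map_of_mem (φ.toRingEquiv : MvPolynomial V K →+* MvPolynomial V K) h1
      have h3 : (φ.toRingEquiv : MvPolynomial V K →+* MvPolynomial V K) (theta u g (-1) p) = p :=
        φ.apply_symm_apply p
      rwa [h3] at h2
    · rw [Ideal.map_le_iff_le_comap]
      exact theta_IZ hsymm u g 1 Z hZ hnb
  let e := Ideal.quotientEquiv (IZ K Adj Z) (IZ K Adj Z) φ.toRingEquiv hmap
  have hX := wr_X (K := K) hirr hsymm (List.ofFn u) Z (List.nodup_ofFn.2 hu)
    (by
      intro x hx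
      obtain ⟨i, rfl⟩ := (List.mem_ofFn' _ _).1 hx
      exact hZ i)
    (by
      intro x hx
      obtain ⟨i, rfl⟩ := (List.mem_ofFn' _ _).1 hx
      exact hnb i)
  refine (AddEquiv.isWeaklyRegular_congr (e := e.toAddEquiv) ?_).1 hX
  rw [List.map_ofFn, List.forall₂_iff_get]
  refine ⟨by simp, ?_⟩
  intro i h1 h2 a
  obtain ⟨p, rfl⟩ := Ideal.Quotient.mk_surjective a
  simp only [List.get_eq_getElem, List.getElem_ofFn, Function.comp]
  set j : Fin k := ⟨i, by simpa using h2⟩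
  have h4 : ∑ x ∈ N j, (X x : MvPolynomial V K) = theta u g 1 (X (u j)) := by
    rw [theta_u u hu, C_1, one_mul, ← Finset.add_sum_erase _ _ (huN j)]
  rw [h4]
  change Ideal.Quotient.mk _ (theta u g 1 (X (u j) * p)) =
    Ideal.Quotient.mk _ (theta u g 1 (X (u j)) * theta u g 1 p)
  rw [map_mul]

lemma wr_main (hirr : ∀ a, ¬ Adj a a) (hsymm : ∀ a b, Adj a b → Adj b a) {k : ℕ}
    (v : Fin k → V)
    (hN : ∀ i j, i ≠ j → Disjoint (insert (v i) (nb Adj (v i))) (insert (v j) (nb Adj (v j)))) :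
    ∀ (d : ℕ) (Z : Finset V), Zᶜ.card = d →
    (∀ i, v i ∉ Z ∨ ∃ w ∈ insert (v i) (nb Adj (v i)), w ∉ Z ∧ nb Adj w ⊆ Z) →
    IsWeaklyRegular (MvPolynomial V K ⧸ IZ K Adj Z)
      (List.ofFn fun i => ∑ x ∈ insert (v i) (nb Adj (v i)), (X x : MvPolynomial V K)) := by
  intro d
  induction d using Nat.strong_induction_on with
  | _ d ih =>
    intro Z hd hinv
    by_cases hterm : ∀ i, ∃ w ∈ insert (v i) (nb Adj (v i)), w ∉ Z ∧ nb Adj w ⊆ Z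
    · choose u hu1 hu2 hu3 using hterm
      exact wr_terminal hirr hsymm _ hN Z u hu1 hu2 hu3
    · push Not at hterm
      obtain ⟨i, hi⟩ := hterm
      have hvi : v i ∉ Z := by
        rcases hinv i with h | ⟨w, hw1, hw2, hw3⟩
        · exact h
        · exact absurd hw3 (hi w hw1 hw2)
      obtain ⟨w, hwn, hwZ⟩ := Finset.not_subset.1 (hi (v i) (Finset.mem_insert_self _ _) hvi)
      have hadj : Adj (v i) w := mem_nb.1 hwn
      have hcard : ∀ Z' : Finset V, Z ⊆ Z' → (∃ x ∈ Z', x ∉ Z) → Z'ᶜ.card < d := by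
        rintro Z' hsub ⟨x, hx1, hx2⟩
        rw [← hd]
        apply Finset.card_lt_card
        rw [Finset.ssubset_iff_of_subset (by simpa using hsub)]
        exact ⟨x, by simpa using hx2, by simpa using hx1⟩
      have hwi : w ∈ insert (v i) (nb Adj (v i)) := Finset.mem_insert_of_mem hwn
      have hnot : ∀ j, j ≠ i → w ∉ insert (v j) (nb Adj (v j)) := fun j hj hw =>
        Finset.disjoint_left.1 (hN j i hj) hw hwi
      refine split_wr hirr hsymm Z hwZ _ ?_ ?_
      · refine ih _ (hcard _ Finset.subset_union_left
          ⟨v i, Finset.mem_union_right _ (mem_nb.2 (hsymm _ _ hadj)), hvi⟩) _ rfl ?_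
        intro j
        by_cases hj : j = i
        · subst hj
          right
          refine ⟨w, hwi, ?_, Finset.subset_union_right⟩
          rw [Finset.mem_union, not_or, mem_nb]
          exact ⟨hwZ, hirr w⟩
        · rcases hinv j with h | ⟨y, hy1, hy2, hy3⟩
          · left
            rw [Finset.mem_union, not_or, mem_nb]
            refine ⟨h, fun hwj => hnot j hj ?_⟩
            exact Finset.mem_insert_of_mem (mem_nb.2 (hsymm _ _ hwj))
          · right
            refine ⟨y, hy1, ?_, hy3.trans Finset.subset_union_left⟩
            rw [Finset.mem_union, not_or, mem_nb]
            exact ⟨hy2, fun hwy => hwZ (hy3 (mem_nb.2 (hsymm _ _ hwy)))⟩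
      · refine ih _ (hcard _ (Finset.subset_insert _ _)
          ⟨w, Finset.mem_insert_self _ _, hwZ⟩) _ rfl ?_
        intro j
        by_cases hj : j = i
        · subst hj
          left
          rw [Finset.mem_insert, not_or]
          refine ⟨?_, hvi⟩
          rintro h
          rw [h] at hadj
          exact hirr _ hadj
        · rcases hinv j with h | ⟨y, hy1, hy2, hy3⟩
          · left
            rw [Finset.mem_insert, not_or]
            refine ⟨?_, h⟩
            rintro h
            exact hnot j hj (by rw [← h]; exact Finset.mem_insert_self _ _)
          · right
            refine ⟨y, hy1, ?_, hy3.trans (Finset.subset_insert _ _)⟩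
            rw [Finset.mem_insert, not_or]
            refine ⟨?_, hy2⟩
            rintro rfl
            exact hnot j hj hy1

lemma exists_regular (hirr : ∀ a, ¬ Adj a a) (hsymm : ∀ a b, Adj a b → Adj b a) {k : ℕ}
    (v : Fin k → V)
    (hN : ∀ i j, i ≠ j → Disjoint (insert (v i) (nb Adj (v i))) (insert (v j) (nb Adj (v j)))) :
    ∃ rs : List (MvPolynomial V K), rs.length = k ∧
      (∀ f ∈ rs, f ∈ Ideal.span (Set.range (X : V → MvPolynomial V K))) ∧
      IsRegular (MvPolynomial V K ⧸ edgeIdeal K Adj) rs := by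
  have hmem : ∀ f ∈ (List.ofFn fun i => ∑ x ∈ insert (v i) (nb Adj (v i)),
      (X x : MvPolynomial V K)), f ∈ Ideal.span (Set.range (X : V → MvPolynomial V K)) := by
    intro f hf
    obtain ⟨i, rfl⟩ := (List.mem_ofFn' _ _).1 hf
    exact Ideal.sum_mem _ fun x _ => Ideal.subset_span ⟨x, rfl⟩
  refine ⟨List.ofFn fun i => ∑ x ∈ insert (v i) (nb Adj (v i)), (X x : MvPolynomial V K),
    by simp, hmem, ?_⟩
  have hE : IZ K Adj ∅ = edgeIdeal K Adj := by simp [IZ]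
  have hw := wr_main (K := K) hirr hsymm v hN _ ∅ rfl (fun i => Or.inl (by simp))
  rw [hE] at hw
  have hle : edgeIdeal K Adj ≤ RingHom.ker (constantCoeff : MvPolynomial V K →+* K) := by
    rw [edgeIdeal, Ideal.span_le]
    rintro _ ⟨a, b, _, rfl⟩
    simp
  have hle2 : Ideal.span (Set.range (X : V → MvPolynomial V K)) ≤
      RingHom.ker (constantCoeff : MvPolynomial V K →+* K) := by
    rw [Ideal.span_le]
    rintro _ ⟨v, rfl⟩
    simp
  refine ⟨hw, ?_⟩
  intro htop
  let ev : (MvPolynomial V K ⧸ edgeIdeal K Adj) →+* K :=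
    Ideal.Quotient.lift _ constantCoeff (fun a ha => hle ha)
  have h0 : ∀ y ∈ (⊤ : Submodule (MvPolynomial V K) (MvPolynomial V K ⧸ edgeIdeal K Adj)),
      ev y = 0 := by
    intro y hy
    rw [htop] at hy
    induction hy using Submodule.smul_induction_on' with
    | smul r hr n hn =>
      obtain ⟨p, rfl⟩ := Ideal.Quotient.mk_surjective n
      have hr' : constantCoeff r = 0 := by
        apply hle2
        exact (Ideal.span_le.2 (fun f hf => hmem f hf)) hr
      change constantCoeff (r * p) = 0
      rw [map_mul, hr', zero_mul]
    | add x hx y hy h1 h2 => rw [map_add, h1, h2, add_zero]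
  have := h0 1 trivial
  rw [map_one] at this
  exact one_ne_zero this

end Lower

end PSS

namespace PSS

section LowerS

variable {K : Type} [Field K] {V : Type} [Fintype V] [DecidableEq V] {Adj : V → V → Prop}

lemma mem_edge (hirr : ∀ a, ¬ Adj a a) (p : MvPolynomial V K) :
    p ∈ edgeIdeal K Adj ↔ ∀ m ∈ p.support, Bad Adj ∅ m := by
  have hE : IZ K Adj ∅ = edgeIdeal K Adj := by simp [IZ]
  rw [← hE, mem_IZ hirr]

/-- The image of a monomial in the quotient. -/
noncomputable def mk1 (K : Type) [Field K] (Adj : V → V → Prop) (e : V →₀ ℕ) :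
    MvPolynomial V K ⧸ edgeIdeal K Adj := Ideal.Quotient.mk _ (monomial e 1)

lemma smul_mk1 (u e : V →₀ ℕ) :
    (monomial u (1 : K) : MvPolynomial V K) • mk1 K Adj e = mk1 K Adj (u + e) := by
  change Ideal.Quotient.mk _ (monomial u 1 * monomial e 1) = _
  rw [monomial_mul, one_mul]
  rfl

lemma mk1_bad (hirr : ∀ a, ¬ Adj a a) {e : V →₀ ℕ} (he : Bad Adj ∅ e) : mk1 K Adj e = 0 := by
  rw [mk1, Ideal.Quotient.eq_zero_iff_mem, mem_edge hirr]
  intro m hm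
  have := support_monomial_subset hm
  rw [Finset.mem_singleton] at this
  rwa [this]

lemma li_mk1 (hirr : ∀ a, ¬ Adj a a) :
    LinearIndependent K (fun e : {e : V →₀ ℕ // ¬ Bad Adj ∅ e} => mk1 K Adj e.1) := by
  let q : MvPolynomial V K →ₗ[K] (MvPolynomial V K ⧸ edgeIdeal K Adj) :=
    (Ideal.Quotient.mkₐ K (edgeIdeal K Adj)).toLinearMap
  have h1 : LinearIndependent K
      (fun e : {e : V →₀ ℕ // ¬ Bad Adj ∅ e} => (monomial e.1 (1 : K) : MvPolynomial V K)) := by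
    have := (basisMonomials V K).linearIndependent.comp
      (fun e : {e : V →₀ ℕ // ¬ Bad Adj ∅ e} => e.1) Subtype.val_injective
    simpa [Function.comp_def] using this
  refine h1.map (f := q) ?_
  rw [Submodule.disjoint_def]
  intro p hp hq
  have hq' : p ∈ edgeIdeal K Adj := Ideal.Quotient.eq_zero_iff_mem.1 hq
  rw [mem_edge hirr] at hq'
  ext e
  rw [coeff_zero]
  by_contra hne
  have hb := hq' e (mem_support_iff.2 hne)
  have hle : Submodule.span K (Set.range fun e : {e : V →₀ ℕ // ¬ Bad Adj ∅ e} =>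
      (monomial e.1 (1 : K) : MvPolynomial V K)) ≤ LinearMap.ker (lcoeff K e) := by
    rw [Submodule.span_le]
    rintro _ ⟨e', rfl⟩
    change coeff e (monomial e'.1 (1 : K)) = 0
    rw [coeff_monomial, if_neg]
    rintro rfl
    exact e'.2 hb
  exact hne (hle hp)

/-- The indicator exponent of a finite set. -/
noncomputable def ind (D : Finset V) : V →₀ ℕ :=
  Finsupp.equivFunOnFinite.symm (fun x => if x ∈ D then 1 else 0)

lemma ind_apply (D : Finset V) (x : V) : ind D x = if x ∈ D then 1 else 0 := rfl

open Classical in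
/-- The top of the interval above `D`. -/
noncomputable def topSet (Adj : V → V → Prop) {k : ℕ} (v : Fin k → V) (D : Finset V) : Finset V :=
  D ∪ (Finset.univ.filter (fun i => Disjoint (nb Adj (v i)) D)).image v

lemma exists_stanley (hirr : ∀ a, ¬ Adj a a) (hsymm : ∀ a b, Adj a b → Adj b a) {k : ℕ}
    (v : Fin k → V)
    (hN : ∀ i j, i ≠ j → Disjoint (insert (v i) (nb Adj (v i))) (insert (v j) (nb Adj (v j)))) :
    ∃ r, ∃ w : Fin r → (MvPolynomial V K ⧸ edgeIdeal K Adj), ∃ A : Fin r → Finset V,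
      IsStanleyDecomp K V _ w A ∧ k ≤ sInf (Set.range fun i => (A i).card) := by
  classical
  let ℐ : Type := {D : Finset V // (∀ a ∈ D, ∀ b ∈ D, ¬ Adj a b) ∧ ∀ i, v i ∉ D}
  have hfin : Fintype ℐ := by dsimp only [ℐ]; infer_instance
  let en : Fin (Fintype.card ℐ) ≃ ℐ := (Fintype.equivFin ℐ).symm
  have hAtop : ∀ (D : Finset V) x, x ∈ topSet Adj v D ↔
      x ∈ D ∨ ∃ i, v i = x ∧ Disjoint (nb Adj (v i)) D := by
    intro D x
    simp only [topSet, Finset.mem_union, Finset.mem_image, Finset.mem_filter, Finset.mem_univ,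
      true_and]
    constructor
    · rintro (h | ⟨i, h1, h2⟩)
      · exact Or.inl h
      · exact Or.inr ⟨i, h2, h1⟩
    · rintro (h | ⟨i, h1, h2⟩)
      · exact Or.inl h
      · exact Or.inr ⟨i, h2, h1⟩
  -- independence of the top sets
  have hind : ∀ (D : ℐ), ∀ a ∈ topSet Adj v D.1, ∀ b ∈ topSet Adj v D.1, ¬ Adj a b := by
    intro D a ha b hb hab
    rw [hAtop] at ha hb
    rcases ha with ha | ⟨i, rfl, hi⟩
    · rcases hb with hb | ⟨j, rfl, hj⟩
      · exact D.2.1 a ha b hb hab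
      · exact Finset.disjoint_left.1 hj (mem_nb.2 (hsymm _ _ hab)) ha
    · rcases hb with hb | ⟨j, rfl, hj⟩
      · exact Finset.disjoint_left.1 hi (mem_nb.2 hab) hb
      · by_cases hij : i = j
        · subst hij; exact hirr _ hab
        · exact Finset.disjoint_left.1 (hN i j hij) (Finset.mem_insert_of_mem (mem_nb.2 hab))
            (Finset.mem_insert_self _ _)
  have hbad : ∀ (D : ℐ) (e : V →₀ ℕ), (∀ x, e x ≠ 0 → x ∈ topSet Adj v D.1) →
      ¬ Bad Adj ∅ e := by
    rintro D e he (⟨z, hz, -⟩ | ⟨a, b, hab, ha, hb⟩)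
    · simp at hz
    · exact hind D a (he a ha) b (he b hb) hab
  let T : ℐ → Set {e : V →₀ ℕ // ¬ Bad Adj ∅ e} := fun D =>
    {e | (∀ x ∈ D.1, e.1 x ≠ 0) ∧ ∀ x, e.1 x ≠ 0 → x ∈ topSet Adj v D.1}
  have hT : ∀ D e, e ∈ T D → ∀ x, x ∈ D.1 ↔ (e.1 x ≠ 0 ∧ ∀ i, v i ≠ x) := by
    rintro D e ⟨h1, h2⟩ x
    constructor
    · intro hx
      exact ⟨h1 x hx, by rintro i rfl; exact D.2.2 i hx⟩
    · rintro ⟨hx, hxv⟩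
      rcases (hAtop _ _).1 (h2 x hx) with h | ⟨i, h, -⟩
      · exact h
      · exact absurd h (hxv i)
  have hsp : ∀ D : ℐ, stanleySpace K V (MvPolynomial V K ⧸ edgeIdeal K Adj)
      (mk1 K Adj (ind D.1)) (topSet Adj v D.1) ≤
      Submodule.span K ((fun e : {e : V →₀ ℕ // ¬ Bad Adj ∅ e} => mk1 K Adj e.1) '' T D) := by
    intro D
    rw [stanleySpace, Submodule.span_le]
    rintro _ ⟨u, hu, rfl⟩
    rw [smul_mk1]
    apply Submodule.subset_span
    have h2 : ∀ x, (u + ind D.1) x ≠ 0 → x ∈ topSet Adj v D.1 := by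
      intro x hx
      rw [Finsupp.add_apply, ind_apply] at hx
      by_cases hxD : x ∈ D.1
      · exact (hAtop _ _).2 (Or.inl hxD)
      · apply hu
        simpa [hxD] using hx
    refine ⟨⟨u + ind D.1, hbad D _ h2⟩, ⟨?_, h2⟩, rfl⟩
    intro x hx
    simp [ind_apply, hx]
  have hempty : (∀ a ∈ (∅ : Finset V), ∀ b ∈ (∅ : Finset V), ¬ Adj a b) ∧
      ∀ i, v i ∉ (∅ : Finset V) := by simp
  refine ⟨Fintype.card ℐ, fun i => mk1 K Adj (ind (en i).1), fun i => topSet Adj v (en i).1,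
    ⟨?_, ?_, ?_⟩, ?_⟩
  · intro i f hf h0
    have h0' : f * monomial (ind (en i).1) 1 ∈ edgeIdeal K Adj :=
      Ideal.Quotient.eq_zero_iff_mem.1 h0
    rw [mem_edge hirr] at h0'
    ext m
    rw [coeff_zero]
    by_contra hne
    have h3 : m + ind (en i).1 ∈ (f * monomial (ind (en i).1) 1).support := by
      rw [mem_support_iff, coeff_mul_monomial, mul_one]
      exact hne
    refine hbad (en i) _ ?_ (h0' _ h3)
    intro x hx
    rw [Finsupp.add_apply, ind_apply] at hx
    by_cases hxD : x ∈ (en i).1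
    · exact (hAtop _ _).2 (Or.inl hxD)
    · apply hf
      have : x ∈ m.support := by simpa [hxD] using hx
      exact (mem_vars x).2 ⟨m, mem_support_iff.2 hne, this⟩
  · intro i
    refine Disjoint.mono (hsp (en i)) (c := _)
      (d := Submodule.span K ((fun e : {e : V →₀ ℕ // ¬ Bad Adj ∅ e} => mk1 K Adj e.1) ''
        ⋃ j, ⋃ (_ : j ≠ i), T (en j))) ?_ ?_
    · refine iSup₂_le fun j hj => (hsp (en j)).trans (Submodule.span_mono (Set.image_mono ?_))
      exact Set.subset_iUnion₂_of_subset j hj subset_rfl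
    · refine (li_mk1 hirr).disjoint_span_image ?_
      rw [Set.disjoint_left]
      rintro e he he'
      simp only [Set.mem_iUnion] at he'
      obtain ⟨j, hj, he'⟩ := he'
      apply hj
      apply en.injective
      apply Subtype.ext
      ext x
      rw [hT _ e he', hT _ e he]
  · rw [eq_top_iff]
    rintro y -
    obtain ⟨p, rfl⟩ := Ideal.Quotient.mk_surjective y
    have hmon : ∀ e, mk1 K Adj e ∈ ⨆ i, stanleySpace K V (MvPolynomial V K ⧸ edgeIdeal K Adj)
        (mk1 K Adj (ind (en i).1)) (topSet Adj v (en i).1) := by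
      intro e
      by_cases he : Bad Adj ∅ e
      · rw [mk1_bad hirr he]; exact Submodule.zero_mem _
      · have hadj : ∀ a b, e a ≠ 0 → e b ≠ 0 → ¬ Adj a b := fun a b ha hb hab =>
          he (Or.inr ⟨a, b, hab, ha, hb⟩)
        let D : ℐ := ⟨e.support.filter (fun x => ∀ i, v i ≠ x), by
          constructor
          · intro a ha b hb
            simp only [Finset.mem_filter, Finsupp.mem_support_iff] at ha hb
            exact hadj a b ha.1 hb.1
          · intro i hi
            simp only [Finset.mem_filter] at hi
            exact hi.2 i rfl⟩
        have hD : ∀ x, x ∈ D.1 ↔ e x ≠ 0 ∧ ∀ i, v i ≠ x := by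
          intro x
          simp [D]
        have hle := le_iSup (fun i => stanleySpace K V (MvPolynomial V K ⧸ edgeIdeal K Adj)
          (mk1 K Adj (ind (en i).1)) (topSet Adj v (en i).1)) (en.symm D)
        apply hle
        simp only [Equiv.apply_symm_apply]
        apply Submodule.subset_span
        refine ⟨e - ind D.1, ?_, ?_⟩
        · intro x hx
          have hex : e x ≠ 0 := by
            intro h
            simp [h] at hx
          rw [Finset.mem_coe, hAtop]
          by_cases hxv : ∃ i, v i = x
          · obtain ⟨i, rfl⟩ := hxv
            right
            refine ⟨i, rfl, ?_⟩
            rw [Finset.disjoint_left]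
            intro y hy hyD
            exact hadj _ _ hex ((hD y).1 hyD).1 (mem_nb.1 hy)
          · left
            push Not at hxv
            exact (hD x).2 ⟨hex, hxv⟩
        · rw [smul_mk1, tsub_add_cancel_of_le]
          intro x
          rw [ind_apply]
          split_ifs with hx
          · exact Nat.one_le_iff_ne_zero.2 ((hD x).1 hx).1
          · exact Nat.zero_le _
    have hp : Ideal.Quotient.mk (edgeIdeal K Adj) p = ∑ e ∈ p.support, coeff e p • mk1 K Adj e := by
      conv_lhs => rw [p.as_sum]
      rw [map_sum]
      refine Finset.sum_congr rfl fun e _ => ?_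
      have : (monomial e (coeff e p) : MvPolynomial V K) = coeff e p • monomial e 1 := by
        rw [smul_monomial, smul_eq_mul, mul_one]
      rw [this]
      rfl
    rw [hp]
    exact Submodule.sum_mem _ fun e _ => Submodule.smul_mem _ _ (hmon e)
  · apply le_csInf
    · exact ⟨_, en.symm ⟨∅, hempty⟩, rfl⟩
    · rintro _ ⟨i, rfl⟩
      have hch : ∀ j : Fin k, ∃ x ∈ topSet Adj v (en i).1, x ∈ insert (v j) (nb Adj (v j)) := by
        intro j
        by_cases h : Disjoint (nb Adj (v j)) (en i).1
        · exact ⟨v j, (hAtop _ _).2 (Or.inr ⟨j, rfl, h⟩), Finset.mem_insert_self _ _⟩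
        · rw [Finset.not_disjoint_iff] at h
          obtain ⟨x, hx1, hx2⟩ := h
          exact ⟨x, (hAtop _ _).2 (Or.inl hx2), Finset.mem_insert_of_mem hx1⟩
      choose c hc1 hc2 using hch
      have hcinj : Function.Injective c := by
        intro a b hab
        by_contra hne
        exact Finset.disjoint_left.1 (hN a b hne) (hc2 a) (hab ▸ hc2 b)
      have := Finset.card_le_card_of_injOn (s := Finset.univ) (t := topSet Adj v (en i).1) c
        (fun j _ => hc1 j) hcinj.injOn
      simpa using this

end LowerS

end PSS

namespace PSS

section Graph

/-- The column of a vertex of `P**_{n,3}`. -/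
def col (n : ℕ) : (Fin n × Fin 3) ⊕ Fin 2 → ℕ
  | Sum.inl a => a.1 + 1
  | Sum.inr b => if b = 0 then n + 1 else 0

/-- Every vertex is on the strip or one of the two extra vertices. -/
lemma vertex_cases {n : ℕ} (a : (Fin n × Fin 3) ⊕ Fin 2) :
    (∃ i j, a = Sum.inl (i, j)) ∨ a = Sum.inr 0 ∨ a = Sum.inr 1 := by
  rcases a with ⟨i, j⟩ | b
  · exact Or.inl ⟨i, j, rfl⟩
  · right
    fin_cases b
    · exact Or.inl rfl
    · exact Or.inr rfl

lemma adj_irrefl (n : ℕ) (a : (Fin n × Fin 3) ⊕ Fin 2) : ¬ pStarStarAdj n a a := by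
  rintro (⟨a', b', h1, h2, h3⟩ | ⟨a', h1 | h1, -⟩ | ⟨a', h1 | h1, -⟩)
  · apply h3.1
    rw [h1] at h2
    exact Sum.inl.inj h2
  all_goals
    obtain ⟨h1, h2⟩ := h1
    rw [h1] at h2
    simp at h2

lemma adj_symm (n : ℕ) (a b : (Fin n × Fin 3) ⊕ Fin 2) (h : pStarStarAdj n a b) :
    pStarStarAdj n b a := by
  rcases h with ⟨a', b', h1, h2, h3, h4, h5⟩ | ⟨a', h1, h2⟩ | ⟨a', h1, h2⟩
  · refine Or.inl ⟨b', a', h2, h1, h3.symm, ?_, ?_⟩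
    · rw [abs_sub_comm]; exact h4
    · rw [abs_sub_comm]; exact h5
  · exact Or.inr (Or.inl ⟨a', by tauto, h2⟩)
  · exact Or.inr (Or.inr ⟨a', by tauto, h2⟩)

lemma adj_col {n : ℕ} {a b : (Fin n × Fin 3) ⊕ Fin 2} (h : pStarStarAdj n a b) :
    col n a ≤ col n b + 1 ∧ col n b ≤ col n a + 1 := by
  rcases h with ⟨a', b', rfl, rfl, h3, h4, h5⟩ | ⟨a', ⟨rfl, rfl⟩ | ⟨rfl, rfl⟩, h2, -⟩ |
    ⟨a', ⟨rfl, rfl⟩ | ⟨rfl, rfl⟩, h2, -⟩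
  · rw [abs_le] at h4
    simp only [col]
    omega
  all_goals
    have := a'.1.2
    simp [col]
    try omega

/-- A packing of closed neighbourhoods. -/
def pk (n : ℕ) (j : ℕ) : (Fin n × Fin 3) ⊕ Fin 2 :=
  if j = 0 then Sum.inr 1
  else if h : 3 * j - 1 < n then Sum.inl (⟨3 * j - 1, h⟩, 1) else Sum.inr 0

lemma col_pk {n j : ℕ} (hj : j < (n + 4) / 3) : col n (pk n j) = 3 * j := by
  unfold pk
  split_ifs with h1 h2
  · simp [col, h1]
  · simp only [col]; omega
  · simp only [col, if_true]; omega

/-- An independent dominating family. -/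
def dm (n : ℕ) (hn : 2 ≤ n) (j : ℕ) : (Fin n × Fin 3) ⊕ Fin 2 :=
  if h : 3 * j < n then Sum.inl (⟨3 * j, h⟩, 1)
  else if 3 * j = n then Sum.inl (⟨n - 1, by omega⟩, 1) else Sum.inr 0

lemma dm_ne {n : ℕ} (hn : 2 ≤ n) {i j : ℕ} (hj : j < (n + 4) / 3) (hij : i < j) :
    col n (dm n hn i) + 2 ≤ col n (dm n hn j) := by
  unfold dm
  rw [dif_pos (by omega)]
  split_ifs with h1 h2
  · simp only [col]; omega
  · simp only [col]; omega
  · simp only [col, if_true]; omega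

lemma adj_mid {n : ℕ} {i i' : Fin n} {j : Fin 3} (hne : ¬ (i = i' ∧ j = 1))
    (h1 : (i : ℕ) ≤ i' + 1) (h2 : (i' : ℕ) ≤ i + 1) :
    pStarStarAdj n (Sum.inl (i, j)) (Sum.inl (i', 1)) := by
  refine Or.inl ⟨_, _, rfl, rfl, ?_, ?_, ?_⟩
  · intro h
    exact hne ⟨congrArg Prod.fst h, congrArg Prod.snd h⟩
  · rw [abs_le]; dsimp only; omega
  · have := j.2
    rw [abs_le]
    simp only [Fin.val_one]
    omega

lemma dm_dom {n : ℕ} (hn : 2 ≤ n) (a : (Fin n × Fin 3) ⊕ Fin 2) :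
    ∃ j, j < (n + 4) / 3 ∧ (a = dm n hn j ∨ pStarStarAdj n a (dm n hn j)) := by
  rcases vertex_cases a with ⟨i, j, rfl⟩ | rfl | rfl
  · have hi := i.2
    refine ⟨((i : ℕ) + 1) / 3, by omega, ?_⟩
    unfold dm
    by_cases h1 : 3 * (((i : ℕ) + 1) / 3) < n
    · rw [dif_pos h1]
      by_cases he : i = ⟨3 * (((i : ℕ) + 1) / 3), h1⟩ ∧ j = 1
      · left
        rw [← he.1, he.2]
      · right
        apply adj_mid he <;> dsimp only <;> omega
    · rw [dif_neg h1, if_pos (by omega)]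
      by_cases he : i = ⟨n - 1, by omega⟩ ∧ j = 1
      · left
        rw [← he.1, he.2]
      · right
        apply adj_mid he <;> dsimp only <;> omega
  · refine ⟨(n + 1) / 3, by omega, ?_⟩
    unfold dm
    split_ifs with h1 h2
    · right
      exact Or.inr (Or.inl ⟨_, Or.inr ⟨rfl, rfl⟩, by dsimp only; omega, Or.inl rfl⟩)
    · right
      exact Or.inr (Or.inl ⟨_, Or.inr ⟨rfl, rfl⟩, rfl, Or.inl rfl⟩)
    · left; rfl
  · refine ⟨0, by omega, Or.inr ?_⟩
    unfold dm
    rw [dif_pos (by omega)]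
    exact Or.inr (Or.inr ⟨_, Or.inr ⟨rfl, rfl⟩, rfl, Or.inl rfl⟩)

lemma exists_dom {n : ℕ} (hn : 2 ≤ n) : ∃ U : Finset ((Fin n × Fin 3) ⊕ Fin 2),
    (∀ a ∈ U, ∀ b ∈ U, ¬ pStarStarAdj n a b) ∧
    (∀ a, a ∉ U → ∃ u ∈ U, pStarStarAdj n a u) ∧ U.card ≤ (n + 4) / 3 := by
  refine ⟨(Finset.range ((n + 4) / 3)).image (dm n hn), ?_, ?_, ?_⟩
  · intro a ha b hb hab
    obtain ⟨i, hi, rfl⟩ := Finset.mem_image.1 ha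
    obtain ⟨j, hj, rfl⟩ := Finset.mem_image.1 hb
    rw [Finset.mem_range] at hi hj
    have hc := adj_col hab
    rcases lt_trichotomy i j with h | rfl | h
    · have := dm_ne hn hj h
      omega
    · exact adj_irrefl n _ hab
    · have := dm_ne hn hi h
      omega
  · intro a ha
    obtain ⟨j, hj, rfl | h⟩ := dm_dom hn a
    · exact absurd (Finset.mem_image_of_mem _ (Finset.mem_range.2 hj)) ha
    · exact ⟨_, Finset.mem_image_of_mem _ (Finset.mem_range.2 hj), h⟩
  · exact Finset.card_image_le.trans (Finset.card_range _).le

lemma pk_disjoint (n : ℕ) (i j : Fin ((n + 4) / 3)) (hij : i ≠ j) :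
    Disjoint (insert (pk n i) (nb (pStarStarAdj n) (pk n i)))
      (insert (pk n j) (nb (pStarStarAdj n) (pk n j))) := by
  have key : ∀ (l : Fin ((n + 4) / 3)) (x : (Fin n × Fin 3) ⊕ Fin 2),
      x ∈ insert (pk n l) (nb (pStarStarAdj n) (pk n l)) →
      col n x ≤ 3 * l + 1 ∧ 3 * (l : ℕ) ≤ col n x + 1 := by
    intro l x hx
    have hl := col_pk l.2
    rcases Finset.mem_insert.1 hx with rfl | hx
    · omega
    · have := adj_col (mem_nb.1 hx)
      omega
  rw [Finset.disjoint_left]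
  intro x hx hx'
  have h1 := key i x hx
  have h2 := key j x hx'
  apply hij
  ext
  omega

end Graph

end PSS

/-- For every integer `n ≥ 2`,
`depth(S**_{n,3}/I(P**_{n,3})) = sdepth(S**_{n,3}/I(P**_{n,3})) = ⌈(n+2)/3⌉`. -/
theorem depth_sdepth_quotient_edgeIdeal_PStarStar_n_3 (K : Type) [Field K] (n : ℕ)
    (hn : 2 ≤ n) :
    rdepth K ((Fin n × Fin 3) ⊕ Fin 2)
        (MvPolynomial ((Fin n × Fin 3) ⊕ Fin 2) K ⧸ edgeIdeal K (pStarStarAdj n)) =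
      (n + 4) / 3 ∧
    sdepth K ((Fin n × Fin 3) ⊕ Fin 2)
        (MvPolynomial ((Fin n × Fin 3) ⊕ Fin 2) K ⧸ edgeIdeal K (pStarStarAdj n)) =
      (n + 4) / 3 := by
  obtain ⟨U, hind, hdom, hU⟩ := PSS.exists_dom hn
  have hN : ∀ i j : Fin ((n + 4) / 3), i ≠ j → _ := PSS.pk_disjoint n
  constructor
  · have hub : ∀ d ∈ { d | ∃ rs : List (MvPolynomial ((Fin n × Fin 3) ⊕ Fin 2) K),
        rs.length = d ∧
        (∀ f ∈ rs, f ∈ Ideal.span (Set.range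
          (X : (Fin n × Fin 3) ⊕ Fin 2 → MvPolynomial ((Fin n × Fin 3) ⊕ Fin 2) K))) ∧
        RingTheory.Sequence.IsRegular
          (MvPolynomial ((Fin n × Fin 3) ⊕ Fin 2) K ⧸ edgeIdeal K (pStarStarAdj n)) rs },
        d ≤ (n + 4) / 3 := by
      rintro d ⟨rs, rfl, h1, h2⟩
      exact (PSS.length_le_card hind hdom rs h1 h2).trans hU
    have hex := PSS.exists_regular (K := K) (PSS.adj_irrefl n) (PSS.adj_symm n)
      (fun j : Fin ((n + 4) / 3) => PSS.pk n j) hN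
    exact le_antisymm (csSup_le ⟨_, hex⟩ hub) (le_csSup ⟨_, hub⟩ hex)
  · have hub : ∀ d ∈ { d | ∃ r,
        ∃ w : Fin r → (MvPolynomial ((Fin n × Fin 3) ⊕ Fin 2) K ⧸
          edgeIdeal K (pStarStarAdj n)),
        ∃ A : Fin r → Finset ((Fin n × Fin 3) ⊕ Fin 2),
        IsStanleyDecomp K _ _ w A ∧ d = sInf (Set.range fun i => (A i).card) },
        d ≤ (n + 4) / 3 := by
      rintro d ⟨r, w, A, h1, rfl⟩
      exact (PSS.stanley_upper hind hdom w A h1).trans hU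
    obtain ⟨r, w, A, h1, h2⟩ := PSS.exists_stanley (K := K) (PSS.adj_irrefl n) (PSS.adj_symm n)
      (fun j : Fin ((n + 4) / 3) => PSS.pk n j) hN
    exact le_antisymm (csSup_le ⟨_, r, w, A, h1, rfl⟩ hub)
      (h2.trans (le_csSup ⟨_, hub⟩ ⟨r, w, A, h1, rfl⟩))
end
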